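/- arXiv:0808.2977 — 2 statements merged into one kernel-verified Lean document; each statement's English description precedes it below -/
import Mathlib

section
/- Consider a system of ordinary differential equations for functions u = (u_1, …, u_n) and v = (v_1, …, v_m) of a real variable x: x du_i/dx = x^{σ_i} f_i(x, u, v) for i = 1, …, n, and x dv_i/dx = −τ_i v_i + x^{ς_i} g_i(x, u, v) for i = 1, …, m, where each τ_i > 0 is a real constant and the σ_i, ς_i ≥ 1 are integers. Let C be an open subset of ℝ^n such that every f_i and g_i is analytic in a neighbourhood of (x, u, v) = (0, c, 0) for each c ∈ C. Then there exists an n-parameter family of solutions of the system: for each c ∈ C there exist x_0(c) > 0 and functions u_i(x; c) (i = 1, …, n) and v_i(x; c) (i = 1, …, m), defined for |x| < x_0(c) and solving the system there, such that u_i(x; c) = c_i + O(x^{σ_i}) and v_i(x; c) = O(x^{ς_i}); moreover the solutions are analytic jointly in x and in the parameters c. -/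
open Filter Asymptotics Topology

theorem mem_eball_of_mem_eball_const {K E : Type*} [TopologicalSpace K] [CompactSpace K]
    [NormedAddCommGroup E] {e : E} {r : ENNReal} {φ : C(K, E)}
    (hφ : φ ∈ Metric.eball (ContinuousMap.const K e) r) (t : K) : φ t ∈ Metric.eball e r := by
  rw [Metric.mem_eball, edist_dist] at hφ ⊢
  refine lt_of_le_of_lt (ENNReal.ofReal_le_ofReal ?_) hφ
  simpa using ContinuousMap.dist_apply_le_dist (f := φ) (g := ContinuousMap.const K e) t

theorem update_eval_apply {K E J : Type*} [TopologicalSpace K] [TopologicalSpace E]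
    [DecidableEq J] (φ : J → C(K, E)) (i : J) (z : C(K, E)) (t : K) :
    (fun j => Function.update φ i z j t) = Function.update (fun j => φ j t) i (z t) := by
  funext j
  rcases eq_or_ne j i with rfl | hj
  · simp
  · simp [hj]

section Superposition

variable {K E G : Type*} [TopologicalSpace K]
  [NormedAddCommGroup E] [NormedSpace ℝ E] [NormedAddCommGroup G] [NormedSpace ℝ G]

open Classical in
/-- The superposition (Nemytskii) operator `φ ↦ F ∘ φ` on continuous functions, with value `0`
where `F ∘ φ` is not continuous. -/
noncomputable def superposition (F : E → G) (φ : C(K, E)) : C(K, G) :=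
  if h : Continuous fun t => F (φ t) then ⟨fun t => F (φ t), h⟩ else 0

theorem superposition_apply_of_ball {F : E → G} {p : FormalMultilinearSeries ℝ E G} {e : E}
    {r : ENNReal} (h : HasFPowerSeriesOnBall F p e r) {φ : C(K, E)}
    (hφ : ∀ t, φ t ∈ Metric.eball e r) (t : K) :
    superposition F φ t = F (φ t) := by
  have hc : Continuous fun t => F (φ t) := h.continuousOn.comp_continuous φ.continuous hφ
  simp [superposition, hc]

variable [CompactSpace K]

/-- A continuous multilinear map acting pointwise on continuous functions. -/
noncomputable def pointwiseMultilinear {n : ℕ}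
    (q : ContinuousMultilinearMap ℝ (fun _ : Fin n => E) G) :
    ContinuousMultilinearMap ℝ (fun _ : Fin n => C(K, E)) C(K, G) :=
  MultilinearMap.mkContinuous
    { toFun := fun φ => ⟨fun t => q fun i => φ i t,
        q.cont.comp (continuous_pi fun i => (φ i).continuous)⟩
      map_update_add' := by
        intro _ φ i x y
        ext t
        simp [update_eval_apply]
      map_update_smul' := by
        intro _ φ i a x
        ext t
        simp [update_eval_apply] }
    ‖q‖ (fun φ => by
      refine (ContinuousMap.norm_le _ (by positivity)).2 fun t => ?_
      refine (q.le_opNorm _).trans ?_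
      gcongr with i
      exact (φ i).norm_coe_le_norm t)

theorem norm_pointwiseMultilinear_le {n : ℕ}
    (q : ContinuousMultilinearMap ℝ (fun _ : Fin n => E) G) :
    ‖pointwiseMultilinear (K := K) q‖ ≤ ‖q‖ :=
  MultilinearMap.mkContinuous_norm_le _ (norm_nonneg _) _

/-- Near a constant function, the superposition operator is composition. -/
theorem eventually_superposition_apply {F : E → G} {e : E} (hF : AnalyticAt ℝ F e) :
    ∀ᶠ φ in 𝓝 (ContinuousMap.const K e), ∀ t, superposition F φ t = F (φ t) := by
  obtain ⟨p, r, h⟩ := hF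
  filter_upwards [Metric.eball_mem_nhds _ h.r_pos] with φ hφ
  exact superposition_apply_of_ball h (mem_eball_of_mem_eball_const hφ)

/-- The superposition operator of a function analytic at `e` is analytic at the constant `e`. -/
theorem analyticAt_superposition [CompleteSpace G] {F : E → G} {e : E}
    (hF : AnalyticAt ℝ F e) :
    AnalyticAt ℝ (superposition (K := K) F) (ContinuousMap.const K e) := by
  obtain ⟨p, r, h⟩ := hF
  let P : FormalMultilinearSeries ℝ C(K, E) C(K, G) := fun n => pointwiseMultilinear (p n)
  have hP : r ≤ P.radius := h.r_le.trans
    (FormalMultilinearSeries.radius_le_of_le fun n => norm_pointwiseMultilinear_le (p n))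
  refine ⟨P, r, hP, h.r_pos, fun {y} hy => ?_⟩
  have hs : Summable fun n => P n fun _ => y :=
    (P.summable_norm_apply (Metric.eball_subset_eball hP hy)).of_norm
  have hyt : ∀ t, y t ∈ Metric.eball (0 : E) r := fun t =>
    mem_eball_of_mem_eball_const (K := K) (e := 0) hy t
  have hval : ∑' n, (P n fun _ => y) = superposition F (ContinuousMap.const K e + y) := by
    ext t
    have h1 : HasSum (fun n => (P n fun _ => y) t) ((∑' n, P n fun _ => y) t) :=
      ContinuousMap.hasSum_apply hs.hasSum t
    have h2 := h.hasSum (hyt t)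
    rw [superposition_apply_of_ball h]
    · exact h1.unique h2
    · intro t
      simpa [Metric.mem_eball, edist_eq_enorm_sub] using hyt t
  exact hval ▸ hs.hasSum

end Superposition

section IntegralEquation

open unitInterval

/-- The operator `h ↦ (t ↦ t ^ k * ∫₀¹ s ^ α * h (s * t) ds)` on continuous
functions on `[0, 1]`. -/
noncomputable def weightedAverage (k : ℕ) {α : ℝ} (hα : 0 ≤ α) : C(I, ℝ) →L[ℝ] C(I, ℝ) :=
  LinearMap.mkContinuous
    { toFun := fun h => ⟨fun t => (t : ℝ) ^ k *
          ∫ s in (0 : ℝ)..1, s ^ α * h (Set.projIcc 0 1 zero_le_one (s * t)), by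
        have h1 : Continuous fun s : ℝ => s ^ α := Real.continuous_rpow_const hα
        refine Continuous.mul (by fun_prop) ?_
        apply intervalIntegral.continuous_parametric_intervalIntegral_of_continuous'
        refine (h1.comp continuous_snd).mul (h.continuous.comp (continuous_projIcc.comp ?_))
        fun_prop⟩
      map_add' := by
        intro g h
        ext t
        have h1 : Continuous fun s : ℝ => s ^ α := Real.continuous_rpow_const hα
        have hi : ∀ h : C(I, ℝ), IntervalIntegrable
            (fun s : ℝ => s ^ α * h (Set.projIcc 0 1 zero_le_one (s * t)))
            MeasureTheory.volume 0 1 := fun h =>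
          (h1.mul (h.continuous.comp (continuous_projIcc.comp (by fun_prop)))).intervalIntegrable _ _
        simp only [ContinuousMap.coe_mk, ContinuousMap.add_apply, mul_add]
        rw [intervalIntegral.integral_add (hi g) (hi h), mul_add]
      map_smul' := by
        intro a h
        ext t
        simp only [ContinuousMap.coe_mk, ContinuousMap.smul_apply, smul_eq_mul, RingHom.id_apply,
          mul_left_comm _ a]
        rw [intervalIntegral.integral_const_mul, mul_left_comm] }
    1 (fun h => by
      rw [one_mul]
      refine (ContinuousMap.norm_le _ (norm_nonneg _)).2 fun t => ?_
      have h1 := intervalIntegral.norm_integral_le_of_norm_le_const (a := 0) (b := 1)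
        (C := ‖h‖) (f := fun s : ℝ => s ^ α * h (Set.projIcc 0 1 zero_le_one (s * t)))
        (fun s hs => by
          rw [Set.uIoc_of_le zero_le_one] at hs
          rw [norm_mul, Real.norm_of_nonneg (Real.rpow_nonneg hs.1.le _)]
          exact (mul_le_of_le_one_left (norm_nonneg _) (Real.rpow_le_one hs.1.le hs.2 hα)).trans
            (h.norm_coe_le_norm _))
      have h2 : ‖(t : ℝ) ^ k‖ ≤ 1 := by
        rw [norm_pow, Real.norm_of_nonneg t.2.1]
        exact pow_le_one₀ t.2.1 t.2.2
      refine (norm_mul_le _ _).trans ((mul_le_of_le_one_left (norm_nonneg _) h2).trans ?_)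
      simpa using h1)

variable {ι : Type*}

/-- The continuous linear map sending `(ε, w)` to the function `t ↦ (ε * t, w t)`. -/
noncomputable def scaledGraph : ℝ × C(I, ι → ℝ) →L[ℝ] C(I, ℝ × (ι → ℝ)) :=
  ((ContinuousLinearMap.inl ℝ ℝ (ι → ℝ)).compLeftContinuous ℝ I ∘L
    ContinuousLinearMap.toSpanSingleton ℝ (⟨fun t => (t : ℝ), by fun_prop⟩ : C(I, ℝ))).coprod
    ((ContinuousLinearMap.inr ℝ ℝ (ι → ℝ)).compLeftContinuous ℝ I)

theorem scaledGraph_apply (ε : ℝ) (w : C(I, ι → ℝ)) (t : I) :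
    scaledGraph (ε, w) t = (ε * t, w t) := by
  simp [scaledGraph]

/-- The weighted average acting on the `i`-th component. -/
noncomputable def componentAverage [DecidableEq ι] (i : ι) (k : ℕ) {α : ℝ} (hα : 0 ≤ α) :
    C(I, ι → ℝ) →L[ℝ] C(I, ι → ℝ) :=
  (ContinuousLinearMap.single ℝ (fun _ : ι => ℝ) i).compLeftContinuous ℝ I ∘L
    weightedAverage k hα ∘L
    (ContinuousLinearMap.proj (R := ℝ) (φ := fun _ : ι => ℝ) i).compLeftContinuous ℝ I

theorem componentAverage_apply [DecidableEq ι] (i : ι) (k : ℕ) {α : ℝ} (hα : 0 ≤ α)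
    (h : C(I, ι → ℝ)) (t : I) :
    componentAverage i k hα h t = Pi.single i ((t : ℝ) ^ k *
      ∫ s in (0 : ℝ)..1, s ^ α * h (Set.projIcc 0 1 zero_le_one (s * t)) i) := rfl

variable [Fintype ι] [DecidableEq ι]

/-- The defect in the integral equation satisfied by a solution `t ↦ w (ε * t)` with initial
value `d`. -/
noncomputable def integralDefect (k : ι → ℕ) {α : ι → ℝ} (hα : ∀ i, 0 ≤ α i)
    (F : ℝ × (ι → ℝ) → ι → ℝ) (q : (ℝ × (ι → ℝ)) × C(I, ι → ℝ)) : C(I, ι → ℝ) :=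
  q.2 - (ContinuousLinearMap.const ℝ I) q.1.2 -
    ∑ i, q.1.1 ^ k i • componentAverage i (k i) (hα i) (superposition F (scaledGraph (q.1.1, q.2)))

theorem integralDefect_eq_zero_iff {k : ι → ℕ} {α : ι → ℝ} (hα : ∀ i, 0 ≤ α i)
    {F : ℝ × (ι → ℝ) → ι → ℝ} {ε : ℝ} {d : ι → ℝ} {w : C(I, ι → ℝ)}
    (hF : ∀ t, superposition F (scaledGraph (ε, w)) t = F (scaledGraph (ε, w) t)) :
    integralDefect k hα F ((ε, d), w) = 0 ↔ ∀ (t : I) (i : ι), w t i = d i + (ε * t) ^ k i *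
      ∫ s in (0 : ℝ)..1, s ^ α i * F (ε * Set.projIcc (0 : ℝ) 1 zero_le_one (s * t),
        w (Set.projIcc 0 1 zero_le_one (s * t))) i := by
  have hval : ∀ (t : I) (i : ι), integralDefect k hα F ((ε, d), w) t i
      = w t i - (d i + (ε * t) ^ k i *
        ∫ s in (0 : ℝ)..1, s ^ α i * F (ε * Set.projIcc (0 : ℝ) 1 zero_le_one (s * t),
          w (Set.projIcc 0 1 zero_le_one (s * t))) i) := by
    intro t i
    simp only [integralDefect, ContinuousMap.sub_apply, ContinuousMap.coe_sum, Finset.sum_apply,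
      ContinuousMap.smul_apply, Pi.sub_apply, Pi.smul_apply, componentAverage_apply, hF,
      scaledGraph_apply, smul_eq_mul, ContinuousLinearMap.const_apply_apply, Pi.single_apply,
      mul_ite, mul_zero, Finset.sum_ite_eq, Finset.mem_univ, if_true, mul_pow]
    ring
  constructor
  · intro h t i
    have := hval t i
    rw [h] at this
    exact sub_eq_zero.1 this.symm
  · intro h
    ext t i
    rw [hval, h t i, sub_self]
    rfl

theorem analyticAt_integralDefect {k : ι → ℕ} {α : ι → ℝ} (hα : ∀ i, 0 ≤ α i)
    {F : ℝ × (ι → ℝ) → ι → ℝ} {d : ι → ℝ} (hF : AnalyticAt ℝ F (0, d)) :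
    AnalyticAt ℝ (integralDefect k hα F) ((0, d), ContinuousMap.const I d) := by
  have hbase : scaledGraph (0, ContinuousMap.const I d) = ContinuousMap.const I (0, d) := by
    ext t <;> simp [scaledGraph_apply]
  have hε : AnalyticAt ℝ (fun q : (ℝ × (ι → ℝ)) × C(I, ι → ℝ) => q.1.1)
      ((0, d), ContinuousMap.const I d) := analyticAt_fst.fun_comp analyticAt_fst
  have hgraph : AnalyticAt ℝ (fun q : (ℝ × (ι → ℝ)) × C(I, ι → ℝ) => scaledGraph (q.1.1, q.2))
      ((0, d), ContinuousMap.const I d) := by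
    have h : AnalyticAt ℝ (fun z : ℝ × C(I, ι → ℝ) => scaledGraph z)
        (0, ContinuousMap.const I d) := ContinuousLinearMap.analyticAt _ _
    exact AnalyticAt.fun_comp (f := fun q : (ℝ × (ι → ℝ)) × C(I, ι → ℝ) => (q.1.1, q.2)) h
      (hε.prod analyticAt_snd)
  have hsup : AnalyticAt ℝ (fun q : (ℝ × (ι → ℝ)) × C(I, ι → ℝ) =>
      superposition F (scaledGraph (q.1.1, q.2))) ((0, d), ContinuousMap.const I d) :=
    AnalyticAt.fun_comp (by rw [hbase]; exact analyticAt_superposition hF) hgraph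
  have hconst : AnalyticAt ℝ (fun q : (ℝ × (ι → ℝ)) × C(I, ι → ℝ) =>
      ContinuousLinearMap.const ℝ I q.1.2) ((0, d), ContinuousMap.const I d) := by
    have h : AnalyticAt ℝ (fun z : ι → ℝ => ContinuousLinearMap.const ℝ I z) d :=
      ContinuousLinearMap.analyticAt _ _
    exact AnalyticAt.fun_comp (f := fun q : (ℝ × (ι → ℝ)) × C(I, ι → ℝ) => q.1.2) h
      (analyticAt_snd.fun_comp analyticAt_fst)
  have hterm : ∀ i, AnalyticAt ℝ (fun q : (ℝ × (ι → ℝ)) × C(I, ι → ℝ) => q.1.1 ^ k i •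
      componentAverage i (k i) (hα i) (superposition F (scaledGraph (q.1.1, q.2))))
      ((0, d), ContinuousMap.const I d) := by
    intro i
    have h : ∀ z, AnalyticAt ℝ (fun z : C(I, ι → ℝ) => componentAverage i (k i) (hα i) z) z :=
      fun z => ContinuousLinearMap.analyticAt _ _
    exact AnalyticAt.fun_smul (hε.fun_pow _) ((h _).fun_comp hsup)
  exact (analyticAt_snd.fun_sub hconst).fun_sub (Finset.analyticAt_fun_sum _ fun i _ => hterm i)

theorem fderiv_integralDefect_comp_inr {k : ι → ℕ} (hk : ∀ i, 1 ≤ k i) {α : ι → ℝ}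
    (hα : ∀ i, 0 ≤ α i) {F : ℝ × (ι → ℝ) → ι → ℝ} {d : ι → ℝ} (hF : AnalyticAt ℝ F (0, d)) :
    fderiv ℝ (integralDefect k hα F) ((0, d), ContinuousMap.const I d) ∘L
      ContinuousLinearMap.inr ℝ (ℝ × (ι → ℝ)) C(I, ι → ℝ) = ContinuousLinearMap.id ℝ _ := by
  have h1 := (analyticAt_integralDefect (k := k) hα hF).differentiableAt.hasFDerivAt.comp
    (ContinuousMap.const I d) (hasFDerivAt_prodMk_right ((0 : ℝ), d) (ContinuousMap.const I d))
  refine h1.unique ?_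
  have h2 : (integralDefect k hα F ∘ fun w => (((0 : ℝ), d), w))
      = fun w => w - (ContinuousLinearMap.const ℝ I) d := by
    funext w
    have : ∀ i, k i ≠ 0 := fun i => Nat.one_le_iff_ne_zero.1 (hk i)
    simp [integralDefect, this]
  rw [h2]
  exact (hasFDerivAt_id _).sub_const _

/-- Analytic solutions of the integral equation, depending analytically on the initial value. -/
theorem exists_analyticAt_integral_equation {k : ι → ℕ} (hk : ∀ i, 1 ≤ k i) {α : ι → ℝ}
    (hα : ∀ i, 0 ≤ α i) {F : ℝ × (ι → ℝ) → ι → ℝ} {d₀ : ι → ℝ} (hF : AnalyticAt ℝ F (0, d₀)) :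
    ∃ w : ℝ × (ι → ℝ) → ι → ℝ, AnalyticAt ℝ w (0, d₀) ∧ w (0, d₀) = d₀ ∧
      ∀ᶠ p in 𝓝 ((0 : ℝ), d₀), ∀ i, w p i = p.2 i + p.1 ^ k i *
        ∫ s in (0 : ℝ)..1, s ^ α i * F (s * p.1, w (s * p.1, p.2)) i := by
  have han := analyticAt_integralDefect (k := k) hα hF
  have hcd := han.contDiffAt (n := ⊤)
  have hinv : (fderiv ℝ (integralDefect k hα F) ((0, d₀), ContinuousMap.const I d₀) ∘L
      ContinuousLinearMap.inr ℝ (ℝ × (ι → ℝ)) C(I, ι → ℝ)).IsInvertible := by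
    rw [fderiv_integralDefect_comp_inr hk hα hF]
    exact ⟨ContinuousLinearEquiv.refl ℝ _, rfl⟩
  set ψ := hcd.implicitFunction (by simp) hinv
  have hψan : AnalyticAt ℝ ψ (0, d₀) :=
    (hcd.contDiffAt_implicitFunction (by simp) hinv).analyticAt
  have hψ0 : ψ (0, d₀) = ContinuousMap.const I d₀ :=
    hcd.implicitFunction_apply_self (by simp) hinv
  have hiff := hcd.eventually_apply_eq_iff_implicitFunction (by simp) hinv
  have hzero : integralDefect k hα F ((0, d₀), ContinuousMap.const I d₀) = 0 := by
    have : ∀ i, k i ≠ 0 := fun i => Nat.one_le_iff_ne_zero.1 (hk i)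
    ext t i
    simp [integralDefect, this]
  have hbase : scaledGraph (0, ContinuousMap.const I d₀) = ContinuousMap.const I (0, d₀) := by
    ext t <;> simp [scaledGraph_apply]
  have hsup : ∀ᶠ q : (ℝ × (ι → ℝ)) × C(I, ι → ℝ) in 𝓝 ((0, d₀), ContinuousMap.const I d₀),
      ∀ t, superposition F (scaledGraph (q.1.1, q.2)) t = F (scaledGraph (q.1.1, q.2) t) := by
    have hc : ContinuousAt (fun q : (ℝ × (ι → ℝ)) × C(I, ι → ℝ) => scaledGraph (q.1.1, q.2))
        ((0, d₀), ContinuousMap.const I d₀) := by fun_prop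
    have h := eventually_superposition_apply (K := I) hF
    rw [← hbase] at h
    exact hc.eventually h
  obtain ⟨r, hr, hball⟩ := Metric.eventually_nhds_iff_ball.1 (hiff.and hsup)
  have hgraph : ∀ᶠ p in 𝓝 ((0 : ℝ), d₀),
      (p, ψ p) ∈ Metric.ball (((0 : ℝ), d₀), ContinuousMap.const I d₀) r := by
    have hc : ContinuousAt (fun p => (p, ψ p)) ((0 : ℝ), d₀) :=
      continuousAt_id.prodMk hψan.continuousAt
    refine hc.eventually (Metric.isOpen_ball.eventually_mem ?_)
    simpa [hψ0] using hr
  refine ⟨fun p => ψ p 1, ?_, by simp [hψ0], ?_⟩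
  · have h : AnalyticAt ℝ (fun z : C(I, ι → ℝ) => ContinuousMap.evalCLM ℝ (1 : I) z) (ψ (0, d₀)) :=
      ContinuousLinearMap.analyticAt _ _
    exact h.fun_comp hψan
  filter_upwards [hgraph] with p hp
  obtain ⟨ε, d⟩ := p
  have heq : ∀ (t : I) (i : ι), ψ (ε, d) t i = d i + (ε * t) ^ k i *
      ∫ s in (0 : ℝ)..1, s ^ α i * F (ε * Set.projIcc (0 : ℝ) 1 zero_le_one (s * t),
        ψ (ε, d) (Set.projIcc 0 1 zero_le_one (s * t))) i := by
    obtain ⟨h1, h2⟩ := hball _ hp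
    rw [hzero] at h1
    exact (integralDefect_eq_zero_iff hα h2).1 (h1.2 rfl)
  have hscale : ∀ l : I, ψ (ε * l, d) 1 = ψ (ε, d) l := by
    intro l
    let wl : C(I, ι → ℝ) := (ψ (ε, d)).comp ⟨fun t => l * t, by fun_prop⟩
    have hmem : (((ε * l : ℝ), d), wl) ∈
        Metric.ball (((0 : ℝ), d₀), ContinuousMap.const I d₀) r := by
      simp only [Metric.mem_ball, Prod.dist_eq, max_lt_iff] at hp ⊢
      obtain ⟨⟨h1, h2⟩, h3⟩ := hp
      refine ⟨⟨?_, h2⟩, ?_⟩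
      · rw [dist_zero_right, norm_mul, Real.norm_of_nonneg l.2.1]
        rw [dist_zero_right] at h1
        exact lt_of_le_of_lt (mul_le_of_le_one_right (norm_nonneg _) l.2.2) h1
      · refine lt_of_le_of_lt ((ContinuousMap.dist_le dist_nonneg).2 fun t => ?_) h3
        exact ContinuousMap.dist_apply_le_dist (f := ψ (ε, d))
          (g := ContinuousMap.const I d₀) (l * t)
    obtain ⟨h1, h2⟩ := hball _ hmem
    rw [hzero] at h1
    have h3 : ψ (ε * l, d) = wl := by
      refine h1.1 ((integralDefect_eq_zero_iff hα h2).2 fun t i => ?_)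
      have h4 := heq (l * t) i
      have h5 : wl t = ψ (ε, d) (l * t) := rfl
      rw [h5, h4, Set.Icc.coe_mul, mul_assoc]
      congr 2
      refine intervalIntegral.integral_congr fun s hs => ?_
      rw [Set.uIcc_of_le zero_le_one] at hs
      have h6 : Set.projIcc (0 : ℝ) 1 zero_le_one (s * (l * t))
          = l * Set.projIcc (0 : ℝ) 1 zero_le_one (s * t) := by
        have hst : s * t ∈ Set.Icc (0 : ℝ) 1 := unitInterval.mul_mem hs t.2
        rw [Set.projIcc_of_mem _ hst, Set.projIcc_of_mem _
          (show s * (l * t) ∈ Set.Icc (0 : ℝ) 1 from unitInterval.mul_mem hs (l * t).2)]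
        ext
        simp only [Set.Icc.coe_mul]
        ring
      have h7 : wl (Set.projIcc (0 : ℝ) 1 zero_le_one (s * t))
          = ψ (ε, d) (l * Set.projIcc (0 : ℝ) 1 zero_le_one (s * t)) := rfl
      simp only [h6, h7, Set.Icc.coe_mul, mul_assoc]
    rw [h3]
    simp [wl]
  intro i
  have h1 := heq 1 i
  simp only [Set.Icc.coe_one, mul_one] at h1
  refine h1.trans ?_
  congr 2
  refine intervalIntegral.integral_congr fun s hs => ?_
  rw [Set.uIcc_of_le zero_le_one] at hs
  have h2 := hscale ⟨s, hs⟩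
  simp only [Set.projIcc_of_mem _ hs, mul_comm s ε, h2]

end IntegralEquation

/-- A solution of the integral equation solves the singular differential equation. -/
theorem mul_deriv_eq_of_integral_equation {y G : ℝ → ℝ} {d τ ρ : ℝ} {k : ℕ} (hk : 1 ≤ k)
    (hτ : 0 ≤ τ) (hG : ∀ x, |x| < ρ → ContinuousAt G x)
    (hy : ∀ x, |x| < ρ → y x = d + x ^ k * ∫ s in (0 : ℝ)..1, s ^ (k + τ - 1) * G (s * x))
    {x : ℝ} (hx : |x| < ρ) (hd : DifferentiableAt ℝ y x) :
    x * deriv y x = -τ * (y x - d) + x ^ k * G x := by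
  have hk' : (1 : ℝ) ≤ k := by exact_mod_cast hk
  have hα : 0 ≤ k + τ - 1 := by linarith
  set α := k + τ - 1 with hαdef
  let Q : ℝ → ℝ := fun t => ∫ r in (0 : ℝ)..t, r ^ α * G (r * x)
  have hcont : ∀ r : ℝ, |r * x| < ρ → ContinuousAt (fun r : ℝ => r ^ α * G (r * x)) r := by
    intro r hr
    have h1 : ContinuousAt (fun r : ℝ => r ^ α) r := (Real.continuous_rpow_const hα).continuousAt
    have h2 : ContinuousAt (fun r : ℝ => G (r * x)) r :=
      ContinuousAt.comp (f := fun r : ℝ => r * x) (hG _ hr) (by fun_prop)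
    exact h1.mul h2
  have hopen : IsOpen {r : ℝ | |r * x| < ρ} := isOpen_lt (by fun_prop) (by fun_prop)
  have hQ : HasDerivAt Q (G x) 1 := by
    have h1 : IntervalIntegrable (fun r : ℝ => r ^ α * G (r * x)) MeasureTheory.volume 0 1 := by
      refine ContinuousOn.intervalIntegrable fun r hr => (hcont r ?_).continuousWithinAt
      rw [Set.uIcc_of_le zero_le_one] at hr
      rw [abs_mul, abs_of_nonneg hr.1]
      exact lt_of_le_of_lt (mul_le_of_le_one_left (abs_nonneg x) hr.2) hx
    have h2 := intervalIntegral.integral_hasDerivAt_right h1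
      (ContinuousOn.stronglyMeasurableAtFilter hopen
        (fun r hr => (hcont r hr).continuousWithinAt) 1 (by simpa using hx))
      (hcont 1 (by simpa using hx))
    simpa using h2
  have heq : (fun t : ℝ => y (t * x)) =ᶠ[𝓝 1] fun t => d + x ^ k * (t ^ (-τ) * Q t) := by
    filter_upwards [lt_mem_nhds (zero_lt_one (α := ℝ)),
      hopen.mem_nhds (show |(1 : ℝ) * x| < ρ by simpa using hx)] with t ht htx
    rw [hy _ htx]
    have h3 : Q t = t * (t ^ α * ∫ s in (0 : ℝ)..1, s ^ α * G (s * (t * x))) := by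
      have := intervalIntegral.mul_integral_comp_mul_right (a := 0) (b := 1)
        (f := fun r : ℝ => r ^ α * G (r * x)) t
      simp only [zero_mul, one_mul] at this
      rw [← intervalIntegral.integral_const_mul]
      simp only [Q]
      rw [← this]
      congr 1
      refine intervalIntegral.integral_congr fun s hs => ?_
      rw [Set.uIcc_of_le zero_le_one] at hs
      rw [Real.mul_rpow hs.1 ht.le]
      ring_nf
    have h4 : t ^ (-τ) * (t * t ^ α) = t ^ k := by
      rw [← Real.rpow_natCast t k, ← Real.rpow_one_add' ht.le (by linarith), ← Real.rpow_add ht]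
      congr 1
      simp only [hαdef]
      ring
    rw [h3, mul_pow, ← h4]
    ring
  have hL : HasDerivAt (fun t : ℝ => y (t * x)) (deriv y x * x) 1 := by
    have h1 : HasDerivAt (fun t : ℝ => t * x) x 1 := by
      simpa using (hasDerivAt_id (1 : ℝ)).mul_const x
    have h2 : HasDerivAt y (deriv y x) ((fun t : ℝ => t * x) 1) := by
      simpa using hd.hasDerivAt
    exact h2.comp 1 h1
  have hR : HasDerivAt (fun t : ℝ => d + x ^ k * (t ^ (-τ) * Q t))
      (x ^ k * (-τ * Q 1 + G x)) 1 := by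
    have h1 := Real.hasDerivAt_rpow_const (x := 1) (p := -τ) (Or.inl one_ne_zero)
    have h2 := ((h1.mul hQ).const_mul (x ^ k)).const_add d
    simpa using h2
  have hE := hL.unique (hR.congr_of_eventuallyEq heq)
  have hx1 := hy x hx
  have hQ1 : Q 1 = ∫ s in (0 : ℝ)..1, s ^ α * G (s * x) := rfl
  rw [← hQ1] at hx1
  rw [hx1, mul_comm, hE]
  ring

/-- A solution of the integral equation deviates from its initial value by `O(x ^ k)`. -/
theorem isBigO_of_integral_equation {y G : ℝ → ℝ} {d α : ℝ} {k : ℕ} (hα : 0 ≤ α)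
    (hG : ContinuousAt G 0)
    (hy : ∀ᶠ x in 𝓝 (0 : ℝ), y x = d + x ^ k * ∫ s in (0 : ℝ)..1, s ^ α * G (s * x)) :
    (fun x => y x - d) =O[𝓝 0] fun x => x ^ k := by
  have hb : ∀ᶠ x in 𝓝 (0 : ℝ), ‖G x‖ < ‖G 0‖ + 1 :=
    hG.norm.eventually_lt_const (lt_add_one _)
  obtain ⟨δ, hδ, hb⟩ := Metric.eventually_nhds_iff.1 hb
  refine IsBigO.of_bound (‖G 0‖ + 1) ?_
  filter_upwards [hy, Metric.ball_mem_nhds (0 : ℝ) hδ] with x hx hxδ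
  rw [hx, add_sub_cancel_left, norm_mul, mul_comm]
  gcongr
  have := intervalIntegral.norm_integral_le_of_norm_le_const (a := 0) (b := 1)
    (C := ‖G 0‖ + 1) (f := fun s : ℝ => s ^ α * G (s * x)) (fun s hs => by
      rw [Set.uIoc_of_le zero_le_one] at hs
      rw [norm_mul, Real.norm_of_nonneg (Real.rpow_nonneg hs.1.le _)]
      have h1 : s ^ α ≤ 1 := Real.rpow_le_one hs.1.le hs.2 hα
      have h2 : ‖G (s * x)‖ < ‖G 0‖ + 1 := by
        apply hb
        simp only [Metric.mem_ball, dist_zero_right, norm_mul] at hxδ ⊢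
        rw [Real.norm_of_nonneg hs.1.le]
        exact lt_of_le_of_lt (mul_le_of_le_one_left (norm_nonneg x) hs.2) hxδ
      have h3 : 0 ≤ ‖G (s * x)‖ := norm_nonneg _
      have h4 : 0 ≤ s ^ α := Real.rpow_nonneg hs.1.le _
      nlinarith)
  simpa using this

/-- Two germs of analytic solutions with the same initial value coincide. -/
theorem eventuallyEq_of_singular_ode {ι : Type*} [Fintype ι] {τ : ι → ℝ} (hτ : ∀ i, 0 ≤ τ i)
    {k : ι → ℕ} (hk : ∀ i, 1 ≤ k i) {F : ℝ × (ι → ℝ) → ι → ℝ} {d : ι → ℝ}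
    (hF : AnalyticAt ℝ F (0, d)) {y z : ℝ → ι → ℝ} (hy : AnalyticAt ℝ y 0)
    (hz : AnalyticAt ℝ z 0) (hy0 : y 0 = d) (hz0 : z 0 = d)
    (hyode : ∀ᶠ x in 𝓝 (0 : ℝ), ∀ i, x * deriv (fun s => y s i) x
      = -τ i * (y x i - d i) + x ^ k i * F (x, y x) i)
    (hzode : ∀ᶠ x in 𝓝 (0 : ℝ), ∀ i, x * deriv (fun s => z s i) x
      = -τ i * (z x i - d i) + x ^ k i * F (x, z x) i) :
    y =ᶠ[𝓝 0] z := by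
  by_contra hne
  have hne' : ¬ ∀ᶠ x in 𝓝 (0 : ℝ), (y - z) x = 0 := by
    intro h
    exact hne (h.mono fun x hx => sub_eq_zero.1 hx)
  obtain ⟨p, h, hh, hh0, heq⟩ :=
    (hy.sub hz).exists_eventuallyEq_pow_smul_nonzero_iff.2 hne'
  simp only [sub_zero] at heq
  have hp : p ≠ 0 := by
    rintro rfl
    have := heq.self_of_nhds
    simp [hy0, hz0] at this
    exact hh0 this.symm
  obtain ⟨L, s, hs, hL⟩ := hF.hasStrictFDerivAt.exists_lipschitzOnWith
  have hys : ∀ᶠ x in 𝓝 (0 : ℝ), (x, y x) ∈ s := by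
    have : ContinuousAt (fun x : ℝ => (x, y x)) 0 := continuousAt_id.prodMk hy.continuousAt
    exact this (by simpa [hy0] using hs)
  have hzs : ∀ᶠ x in 𝓝 (0 : ℝ), (x, z x) ∈ s := by
    have : ContinuousAt (fun x : ℝ => (x, z x)) 0 := continuousAt_id.prodMk hz.continuousAt
    exact this (by simpa [hz0] using hs)
  apply hh0
  funext i
  have hyi : ∀ᶠ x in 𝓝 (0 : ℝ), AnalyticAt ℝ (fun s => y s i) x := by
    filter_upwards [hy.eventually_analyticAt] with x hx
    exact analyticAt_pi_iff.1 hx i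
  have hzi : ∀ᶠ x in 𝓝 (0 : ℝ), AnalyticAt ℝ (fun s => z s i) x := by
    filter_upwards [hz.eventually_analyticAt] with x hx
    exact analyticAt_pi_iff.1 hx i
  have hhi : AnalyticAt ℝ (fun s => h s i) 0 := analyticAt_pi_iff.1 hh i
  have hbound : ∀ᶠ x in 𝓝[≠] (0 : ℝ),
      |(p + τ i) * h x i + x * deriv (fun s => h s i) x| ≤ |x| ^ k i * (L * ‖h x‖) := by
    filter_upwards [hyode.filter_mono nhdsWithin_le_nhds, hzode.filter_mono nhdsWithin_le_nhds,
      hys.filter_mono nhdsWithin_le_nhds, hzs.filter_mono nhdsWithin_le_nhds,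
      hyi.filter_mono nhdsWithin_le_nhds, hzi.filter_mono nhdsWithin_le_nhds,
      hhi.eventually_analyticAt.filter_mono nhdsWithin_le_nhds,
      heq.eventually_nhds.filter_mono nhdsWithin_le_nhds, self_mem_nhdsWithin]
      with x hyx hzx hyx' hzx' hya hza hha hex hx0
    have hx0 : x ≠ 0 := hx0
    have hlip : ‖F (x, y x) - F (x, z x)‖ ≤ L * (|x| ^ p * ‖h x‖) := by
      have h1 := hL.norm_sub_le hyx' hzx'
      have h2 : (x, y x) - (x, z x) = ((0 : ℝ), x ^ p • h x) := by
        rw [← hex.self_of_nhds]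
        simp
      rw [h2] at h1
      have h3 : 0 ≤ |x| ^ p * ‖h x‖ := by positivity
      simpa [Prod.norm_def, norm_smul, h3] using h1
    have hd1 : deriv (fun s => y s i) x - deriv (fun s => z s i) x
        = p * x ^ (p - 1) * h x i + x ^ p * deriv (fun s => h s i) x := by
      have h1 : HasDerivAt (fun s => y s i - z s i) _ x :=
        hya.differentiableAt.hasDerivAt.sub hza.differentiableAt.hasDerivAt
      have h2 : HasDerivAt (fun s => s ^ p * h s i) _ x :=
        (hasDerivAt_pow p x).mul hha.differentiableAt.hasDerivAt
      refine h1.unique (h2.congr_of_eventuallyEq ?_)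
      filter_upwards [hex] with s hs
      simpa using congrFun hs i
    have hxp : x * x ^ (p - 1) = x ^ p := by
      rw [← pow_succ', Nat.sub_add_cancel (Nat.one_le_iff_ne_zero.2 hp)]
    have hδ : y x i - z x i = x ^ p * h x i := by simpa using congrFun hex.self_of_nhds i
    have key : x ^ p * ((p + τ i) * h x i + x * deriv (fun s => h s i) x)
        = x ^ k i * (F (x, y x) - F (x, z x)) i := by
      have e1 : x * (deriv (fun s => y s i) x - deriv (fun s => z s i) x)
          = -τ i * (y x i - z x i) + x ^ k i * (F (x, y x) - F (x, z x)) i := by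
        rw [mul_sub, hyx i, hzx i, Pi.sub_apply]
        ring
      rw [hd1, hδ] at e1
      rw [← hxp] at e1 ⊢
      linear_combination e1
    have hxpos : 0 < |x| ^ p := by positivity
    refine le_of_mul_le_mul_left ?_ hxpos
    calc |x| ^ p * |(p + τ i) * h x i + x * deriv (fun s => h s i) x|
        = |x| ^ k i * ‖(F (x, y x) - F (x, z x)) i‖ := by
          rw [← abs_pow, ← abs_mul, key, abs_mul, abs_pow, Real.norm_eq_abs]
      _ ≤ |x| ^ k i * (L * (|x| ^ p * ‖h x‖)) := by
          gcongr
          exact (norm_le_pi_norm _ i).trans hlip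
      _ = |x| ^ p * (|x| ^ k i * (L * ‖h x‖)) := by ring
  have hcd : ContinuousAt (deriv fun s => h s i) 0 := hhi.deriv.continuousAt
  have hl : ContinuousAt
      (fun x => |(p + τ i) * h x i + x * deriv (fun s => h s i) x|) 0 :=
    ((hhi.continuousAt.const_mul _).add (continuousAt_id.mul hcd)).abs
  have hr : ContinuousAt (fun x => |x| ^ k i * (L * ‖h x‖)) 0 :=
    (continuousAt_id.abs.pow _).mul (hh.continuousAt.norm.const_mul _)
  have hlim := le_of_tendsto_of_tendsto (hl.tendsto.mono_left nhdsWithin_le_nhds)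
    (hr.tendsto.mono_left nhdsWithin_le_nhds) hbound
  have hki : k i ≠ 0 := Nat.one_le_iff_ne_zero.1 (hk i)
  have hpos : (0 : ℝ) < p + τ i :=
    add_pos_of_pos_of_nonneg (by exact_mod_cast Nat.pos_of_ne_zero hp) (hτ i)
  have hzero : |(p + τ i) * h 0 i| ≤ 0 := by simpa [hki] using hlim
  exact (mul_eq_zero.1 (abs_nonpos_iff.1 hzero)).resolve_left hpos.ne'

section SingularODE

variable {ι : Type*} [Fintype ι]

/-- `y` is an analytic solution on `|x| < R` of the singular system
`x yᵢ' = -τᵢ (yᵢ - dᵢ) + x ^ kᵢ Fᵢ(x, y)` with `y 0 = d`. -/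
structure IsSingularSolution (τ : ι → ℝ) (k : ι → ℕ) (F : ℝ × (ι → ℝ) → ι → ℝ) (d : ι → ℝ)
    (R : ℝ) (y : ℝ → ι → ℝ) : Prop where
  pos : 0 < R
  analyticAt : ∀ x ∈ Set.Ioo (-R) R, AnalyticAt ℝ y x
  initial : y 0 = d
  ode : ∀ x ∈ Set.Ioo (-R) R, ∀ i, x * deriv (fun s => y s i) x
    = -τ i * (y x i - d i) + x ^ k i * F (x, y x) i

variable {τ : ι → ℝ} {k : ι → ℕ} {F : ℝ × (ι → ℝ) → ι → ℝ}

theorem IsSingularSolution.mono {d : ι → ℝ} {R R' : ℝ} {y : ℝ → ι → ℝ}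
    (h : IsSingularSolution τ k F d R y) (hR' : 0 < R') (hle : R' ≤ R) :
    IsSingularSolution τ k F d R' y where
  pos := hR'
  analyticAt x hx := h.analyticAt x (Set.Ioo_subset_Ioo (neg_le_neg hle) hle hx)
  initial := h.initial
  ode x hx := h.ode x (Set.Ioo_subset_Ioo (neg_le_neg hle) hle hx)

theorem IsSingularSolution.eqOn (hτ : ∀ i, 0 ≤ τ i) (hk : ∀ i, 1 ≤ k i) {d : ι → ℝ}
    (hF : AnalyticAt ℝ F (0, d)) {R : ℝ} {y z : ℝ → ι → ℝ}
    (hy : IsSingularSolution τ k F d R y) (hz : IsSingularSolution τ k F d R z) :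
    Set.EqOn y z (Set.Ioo (-R) R) := by
  have h0 : (0 : ℝ) ∈ Set.Ioo (-R) R := ⟨neg_lt_zero.2 hy.pos, hy.pos⟩
  have hev := isOpen_Ioo.mem_nhds h0
  exact AnalyticOnNhd.eqOn_of_preconnected_of_eventuallyEq hy.analyticAt hz.analyticAt
    isPreconnected_Ioo h0 (eventuallyEq_of_singular_ode hτ hk hF (hy.analyticAt 0 h0)
      (hz.analyticAt 0 h0) hy.initial hz.initial (Filter.mem_of_superset hev hy.ode)
      (Filter.mem_of_superset hev hz.ode))

/-- Local solutions of the singular system, analytic in the variable and in the initial value. -/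
theorem exists_local_singular_solution (hτ : ∀ i, 0 ≤ τ i) (hk : ∀ i, 1 ≤ k i) {d₀ : ι → ℝ}
    (hF : AnalyticAt ℝ F (0, d₀)) :
    ∃ (w : ℝ × (ι → ℝ) → ι → ℝ) (ρ : ℝ), 0 < ρ ∧
      ∀ d ∈ Metric.ball d₀ ρ, AnalyticAt ℝ F (0, d) ∧
        (∀ x ∈ Set.Ioo (-ρ) ρ, AnalyticAt ℝ w (x, d)) ∧
        IsSingularSolution τ k F d ρ (fun x => w (x, d)) ∧
        ∀ i, (fun x => w (x, d) i - d i) =O[𝓝 0] fun x => x ^ k i := by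
  classical
  have hk' : ∀ i, (1 : ℝ) ≤ k i := fun i => by exact_mod_cast hk i
  have hα : ∀ i, 0 ≤ k i + τ i - 1 := fun i => by linarith [hτ i, hk' i]
  obtain ⟨w, hw, hw0, heq⟩ := exists_analyticAt_integral_equation hk hα hF
  have hFw : ∀ᶠ p in 𝓝 ((0 : ℝ), d₀), AnalyticAt ℝ F (p.1, w p) := by
    have hc : ContinuousAt (fun p : ℝ × (ι → ℝ) => (p.1, w p)) ((0 : ℝ), d₀) :=
      continuousAt_fst.prodMk hw.continuousAt
    refine hc.eventually ?_
    simpa only [hw0] using hF.eventually_analyticAt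
  obtain ⟨ρ, hρ, hball⟩ := Metric.eventually_nhds_iff_ball.1
    (hw.eventually_analyticAt.and (hFw.and heq))
  refine ⟨w, ρ, hρ, fun d hd => ?_⟩
  have hmem : ∀ x : ℝ, |x| < ρ → (x, d) ∈ Metric.ball ((0 : ℝ), d₀) ρ := fun x hx => by
    rw [Metric.mem_ball, Prod.dist_eq]
    exact max_lt (by simpa using hx) hd
  have hFw' : ∀ x : ℝ, |x| < ρ → AnalyticAt ℝ (fun s => F (s, w (s, d))) x := by
    intro x hx
    obtain ⟨h1, h2, -⟩ := hball _ (hmem x hx)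
    have h3 : AnalyticAt ℝ (fun s : ℝ => (s, d)) x := analyticAt_id.prod analyticAt_const
    have h4 : AnalyticAt ℝ (fun s : ℝ => w (s, d)) x :=
      AnalyticAt.fun_comp (f := fun s : ℝ => (s, d)) h1 h3
    exact AnalyticAt.fun_comp (f := fun s : ℝ => (s, w (s, d))) h2 (analyticAt_id.prod h4)
  have hcont : ∀ i, ∀ x : ℝ, |x| < ρ → ContinuousAt (fun s => F (s, w (s, d)) i) x :=
    fun i x hx => (analyticAt_pi_iff.1 (hFw' x hx) i).continuousAt
  have heq' : ∀ i, ∀ x : ℝ, |x| < ρ → w (x, d) i = d i + x ^ k i *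
      ∫ s in (0 : ℝ)..1, s ^ (k i + τ i - 1) * F (s * x, w (s * x, d)) i :=
    fun i x hx => (hball _ (hmem x hx)).2.2 i
  have hzero_time : w (0, d) = d := by
    funext i
    have := heq' i 0 (by simpa using hρ)
    simpa [Nat.one_le_iff_ne_zero.1 (hk i)] using this
  have hwan : ∀ x ∈ Set.Ioo (-ρ) ρ, AnalyticAt ℝ (fun s : ℝ => w (s, d)) x := fun x hx =>
    AnalyticAt.fun_comp (f := fun s : ℝ => (s, d)) (hball _ (hmem x (abs_lt.2 hx))).1
      (analyticAt_id.prod analyticAt_const)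
  refine ⟨?_, fun x hx => (hball _ (hmem x (abs_lt.2 hx))).1, ⟨hρ, hwan, hzero_time, ?_⟩, ?_⟩
  · simpa only [hzero_time] using (hball _ (hmem 0 (by simpa using hρ))).2.1
  · intro x hx i
    exact mul_deriv_eq_of_integral_equation (G := fun s => F (s, w (s, d)) i) (hk i) (hτ i)
      (hcont i) (heq' i) (abs_lt.2 hx) (analyticAt_pi_iff.1 (hwan x hx) i).differentiableAt
  · intro i
    refine isBigO_of_integral_equation (G := fun s => F (s, w (s, d)) i) (hα i)
      (hcont i 0 (by simpa using hρ)) ?_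
    filter_upwards [Metric.ball_mem_nhds (0 : ℝ) hρ] with x hx
    exact heq' i x (by simpa using hx)

open Classical in
/-- The value at `x` of any solution with initial value `d` whose domain contains `x`. -/
noncomputable def singularFlow (τ : ι → ℝ) (k : ι → ℕ) (F : ℝ × (ι → ℝ) → ι → ℝ)
    (p : ℝ × (ι → ℝ)) : ι → ℝ :=
  if h : ∃ y : ℝ → ι → ℝ, ∃ R, p.1 ∈ Set.Ioo (-R) R ∧ IsSingularSolution τ k F p.2 R y
  then h.choose p.1 else 0

/-- The flow agrees with every solution on its domain. -/
theorem singularFlow_eq (hτ : ∀ i, 0 ≤ τ i) (hk : ∀ i, 1 ≤ k i) {d : ι → ℝ}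
    (hF : AnalyticAt ℝ F (0, d)) {R : ℝ} {y : ℝ → ι → ℝ} (hy : IsSingularSolution τ k F d R y)
    {x : ℝ} (hx : x ∈ Set.Ioo (-R) R) : singularFlow τ k F (x, d) = y x := by
  have h : ∃ z : ℝ → ι → ℝ, ∃ R', x ∈ Set.Ioo (-R') R' ∧ IsSingularSolution τ k F d R' z :=
    ⟨y, R, hx, hy⟩
  have hval : singularFlow τ k F (x, d) = h.choose x := dif_pos h
  obtain ⟨R', hx', hz⟩ := h.choose_spec
  have hpos : 0 < min R R' := lt_min hy.pos hz.pos
  rw [hval]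
  refine ((hz.mono hpos (min_le_right _ _)).eqOn hτ hk hF (hy.mono hpos (min_le_left _ _))) ?_
  exact abs_lt.1 (lt_min (abs_lt.2 hx) (abs_lt.2 hx'))

/-- The flow is locally an analytic family of solutions. -/
theorem exists_singularFlow_radius (hτ : ∀ i, 0 ≤ τ i) (hk : ∀ i, 1 ≤ k i) {d : ι → ℝ}
    (hF : AnalyticAt ℝ F (0, d)) :
    ∃ ρ > 0, (∀ x ∈ Set.Ioo (-ρ) ρ, AnalyticAt ℝ (singularFlow τ k F) (x, d)) ∧
      IsSingularSolution τ k F d ρ (fun x => singularFlow τ k F (x, d)) ∧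
      ∀ i, (fun x => singularFlow τ k F (x, d) i - d i) =O[𝓝 0] fun x => x ^ k i := by
  obtain ⟨w, ρ, hρ, hw⟩ := exists_local_singular_solution hτ hk hF
  have hflow : ∀ d' ∈ Metric.ball d ρ, ∀ x ∈ Set.Ioo (-ρ) ρ,
      singularFlow τ k F (x, d') = w (x, d') := fun d' hd' x hx =>
    singularFlow_eq hτ hk (hw d' hd').1 (hw d' hd').2.2.1 hx
  have hd := Metric.mem_ball_self (x := d) hρ
  obtain ⟨-, hwan, hsol, hO⟩ := hw d hd
  have hnear : ∀ x ∈ Set.Ioo (-ρ) ρ, (fun s => w (s, d)) =ᶠ[𝓝 x]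
      fun s => singularFlow τ k F (s, d) := fun x hx => by
    filter_upwards [isOpen_Ioo.mem_nhds hx] with s hs
    exact (hflow d hd s hs).symm
  have h0 : (0 : ℝ) ∈ Set.Ioo (-ρ) ρ := ⟨neg_lt_zero.2 hρ, hρ⟩
  refine ⟨ρ, hρ, fun x hx => (hwan x hx).congr ?_, ⟨hρ, ?_, ?_, ?_⟩, fun i => ?_⟩
  · filter_upwards [(isOpen_Ioo.prod Metric.isOpen_ball).mem_nhds (Set.mk_mem_prod hx hd)]
      with p hp
    exact (hflow p.2 hp.2 p.1 hp.1).symm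
  · exact fun x hx => (hsol.analyticAt x hx).congr (hnear x hx)
  · exact (hflow d hd 0 h0).trans hsol.initial
  · intro x hx i
    rw [hflow d hd x hx, ← hsol.ode x hx i]
    congr 1
    refine Filter.EventuallyEq.deriv_eq ?_
    filter_upwards [hnear x hx] with s hs
    exact congrFun hs.symm i
  · refine (hO i).congr' ?_ EventuallyEq.rfl
    filter_upwards [hnear 0 h0] with s hs
    rw [hs]

end SingularODE

/-- **Theorem (Breitenlohner–Forgács–Maison local existence).**
For the singular system x u_i′ = x^{σ_i} f_i(x,u,v), x v_i′ = −τ_i v_i + x^{ς_i} g_i(x,u,v),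
with τ_i > 0, σ_i, ς_i ≥ 1 and f_i, g_i analytic near (0,c,0) for every c in an open set C,
there is an n-parameter family of solutions u(x;c), v(x;c), defined for |x| < x₀(c), with
u_i(x;c) = c_i + O(x^{σ_i}), v_i(x;c) = O(x^{ς_i}), analytic jointly in x and c. -/
theorem bfm_local_existence
    (n m : ℕ) (σ : Fin n → ℕ) (ς : Fin m → ℕ) (τ : Fin m → ℝ)
    (hτ : ∀ i, 0 < τ i) (hσ : ∀ i, 1 ≤ σ i) (hς : ∀ i, 1 ≤ ς i)
    (C : Set (Fin n → ℝ)) (hC : IsOpen C)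
    (f : Fin n → ℝ × (Fin n → ℝ) × (Fin m → ℝ) → ℝ)
    (g : Fin m → ℝ × (Fin n → ℝ) × (Fin m → ℝ) → ℝ)
    (hf : ∀ c ∈ C, ∀ i, AnalyticAt ℝ (f i) (0, c, 0))
    (hg : ∀ c ∈ C, ∀ i, AnalyticAt ℝ (g i) (0, c, 0)) :
    ∃ (x₀ : (Fin n → ℝ) → ℝ)
      (u : ℝ → (Fin n → ℝ) → Fin n → ℝ)
      (v : ℝ → (Fin n → ℝ) → Fin m → ℝ),
      ∀ c ∈ C,
        0 < x₀ c ∧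
        (∀ x : ℝ, |x| < x₀ c →
          (∀ i : Fin n,
            x * deriv (fun y : ℝ => u y c i) x = x ^ σ i * f i (x, u x c, v x c)) ∧
          (∀ i : Fin m,
            x * deriv (fun y : ℝ => v y c i) x
              = -τ i * v x c i + x ^ ς i * g i (x, u x c, v x c))) ∧
        (∀ i : Fin n, (fun x : ℝ => u x c i - c i) =O[𝓝 (0 : ℝ)] fun x => x ^ σ i) ∧
        (∀ i : Fin m, (fun x : ℝ => v x c i) =O[𝓝 (0 : ℝ)] fun x => x ^ ς i) ∧
        (∀ x : ℝ, |x| < x₀ c →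
          (∀ i : Fin n,
            AnalyticAt ℝ (fun p : ℝ × (Fin n → ℝ) => u p.1 p.2 i) (x, c)) ∧
          (∀ i : Fin m,
            AnalyticAt ℝ (fun p : ℝ × (Fin n → ℝ) => v p.1 p.2 i) (x, c))) := by
  let τ' : Fin n ⊕ Fin m → ℝ := Sum.elim (fun _ => 0) τ
  let k : Fin n ⊕ Fin m → ℕ := Sum.elim σ ς
  let F : ℝ × (Fin n ⊕ Fin m → ℝ) → Fin n ⊕ Fin m → ℝ := fun p =>
    Sum.elim (fun i => f i (p.1, fun j => p.2 (Sum.inl j), fun j => p.2 (Sum.inr j)))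
      (fun i => g i (p.1, fun j => p.2 (Sum.inl j), fun j => p.2 (Sum.inr j)))
  let embed : (Fin n → ℝ) → Fin n ⊕ Fin m → ℝ := fun c => Sum.elim c 0
  have hτ' : ∀ i, 0 ≤ τ' i := by
    rintro (i | i)
    · exact le_rfl
    · exact (hτ i).le
  have hk : ∀ i, 1 ≤ k i := by
    rintro (i | i)
    · exact hσ i
    · exact hς i
  have hF : ∀ c ∈ C, AnalyticAt ℝ F (0, embed c) := by
    intro c hc
    have hproj : ∀ i, AnalyticAt ℝ (fun p : ℝ × (Fin n ⊕ Fin m → ℝ) => p.2 i) (0, embed c) :=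
      fun i => ((ContinuousLinearMap.proj (R := ℝ) (φ := fun _ : Fin n ⊕ Fin m => ℝ) i).analyticAt
        _).fun_comp analyticAt_snd
    have hsplit : AnalyticAt ℝ (fun p : ℝ × (Fin n ⊕ Fin m → ℝ) =>
        (p.1, (fun j => p.2 (Sum.inl j) : Fin n → ℝ), (fun j => p.2 (Sum.inr j) : Fin m → ℝ)))
        (0, embed c) :=
      analyticAt_fst.prod ((analyticAt_pi_iff.2 fun j => hproj (Sum.inl j)).prod
        (analyticAt_pi_iff.2 fun j => hproj (Sum.inr j)))
    refine analyticAt_pi_iff.2 ?_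
    rintro (i | i)
    · exact AnalyticAt.fun_comp (g := f i) (hf c hc i) hsplit
    · exact AnalyticAt.fun_comp (g := g i) (hg c hc i) hsplit
  have hembed : ∀ (c : Fin n → ℝ), AnalyticAt ℝ embed c := by
    intro c
    refine analyticAt_pi_iff.2 ?_
    rintro (i | i)
    · exact (ContinuousLinearMap.proj (R := ℝ) (φ := fun _ : Fin n => ℝ) i).analyticAt _
    · exact analyticAt_const
  have hrad : ∀ c, ∃ ρ : ℝ, c ∈ C → 0 < ρ ∧
      (∀ x ∈ Set.Ioo (-ρ) ρ, AnalyticAt ℝ (singularFlow τ' k F) (x, embed c)) ∧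
      IsSingularSolution τ' k F (embed c) ρ (fun x => singularFlow τ' k F (x, embed c)) ∧
      ∀ i, (fun x => singularFlow τ' k F (x, embed c) i - embed c i) =O[𝓝 0] fun x => x ^ k i := by
    intro c
    by_cases hc : c ∈ C
    · obtain ⟨ρ, hρ, h⟩ := exists_singularFlow_radius hτ' hk (hF c hc)
      exact ⟨ρ, fun _ => ⟨hρ, h⟩⟩
    · exact ⟨0, fun h => absurd h hc⟩
  choose x₀ hx₀ using hrad
  refine ⟨x₀, fun x c i => singularFlow τ' k F (x, embed c) (Sum.inl i),
    fun x c i => singularFlow τ' k F (x, embed c) (Sum.inr i), fun c hc => ?_⟩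
  obtain ⟨hpos, han, hsol, hO⟩ := hx₀ c hc
  have hjoint : ∀ x : ℝ, |x| < x₀ c → AnalyticAt ℝ
      (fun p : ℝ × (Fin n → ℝ) => singularFlow τ' k F (p.1, embed p.2)) (x, c) := fun x hx =>
    AnalyticAt.fun_comp (f := fun p : ℝ × (Fin n → ℝ) => (p.1, embed p.2)) (han x (abs_lt.1 hx))
      (analyticAt_fst.prod ((hembed c).fun_comp analyticAt_snd))
  refine ⟨hpos, fun x hx => ⟨fun i => ?_, fun i => ?_⟩, fun i => hO (Sum.inl i), fun i => ?_,
    fun x hx => ⟨fun i => analyticAt_pi_iff.1 (hjoint x hx) (Sum.inl i),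
      fun i => analyticAt_pi_iff.1 (hjoint x hx) (Sum.inr i)⟩⟩
  · simpa [τ', k, F] using hsol.ode x (abs_lt.1 hx) (Sum.inl i)
  · simpa [τ', k, F, embed] using hsol.ode x (abs_lt.1 hx) (Sum.inr i)
  · simpa [k, embed] using hO (Sum.inr i)
end

section
/- For every Λ < 0, every S_0 > 0 and every (z̄_2, …, z̄_N) ∈ ℝ^{N−1}, there exist ε > 0 and a solution (m, S, ω_1, …, ω_{N−1}) of the su(N) EYM field equations on (0, ε) with the following properties: m(r) = O(r³) as r → 0⁺; S(r) = S_0 + O(r²); and the vector function u(r) with components u_j(r) = ω_j(r)/√(j(N−j)) has the exact form u(r) = (1, 1, …, 1)ᵀ + Σ_{k=2}^{N} ζ_k(r) v_k r^k, where each scalar function ζ_k is analytic at r = 0 with ζ_k(0) = z̄_k. Moreover the solution is analytic in r and depends analytically on the N+1 parameters (Λ, S_0, z̄_2, …, z̄_N); this is an (N+1)-parameter family of local solutions near the origin. -/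
open Filter Asymptotics Topology

noncomputable section

/-- μ(r) = 1 − 2m(r)/r − Λr²/3. -/
def muF (Λ : ℝ) (m : ℝ → ℝ) (r : ℝ) : ℝ := 1 - 2 * m r / r - Λ * r ^ 2 / 3

/-- G = Σ_{j=1}^{N−1} (ω_j′)². -/
def GF (N : ℕ) (ω : ℕ → ℝ → ℝ) (r : ℝ) : ℝ :=
  ∑ j ∈ Finset.Icc 1 (N - 1), deriv (ω j) r ^ 2

/-- p_θ evaluated on a set of gauge-field values `w`. -/
def pThetaVal (N : ℕ) (w : ℕ → ℝ) (r : ℝ) : ℝ :=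
  1 / (4 * r ^ 4) *
    ∑ j ∈ Finset.Icc 1 N, (w j ^ 2 - w (j - 1) ^ 2 - (N : ℝ) - 1 + 2 * (j : ℝ)) ^ 2

/-- p_θ = (1/4r⁴) Σ_{j=1}^{N} (ω_j² − ω_{j−1}² − N − 1 + 2j)². -/
def pTheta (N : ℕ) (ω : ℕ → ℝ → ℝ) (r : ℝ) : ℝ := pThetaVal N (fun j => ω j r) r

/-- W_j evaluated on gauge-field values `w`. -/
def WVal (w : ℕ → ℝ) (j : ℕ) : ℝ :=
  1 - w j ^ 2 + 1 / 2 * (w (j - 1) ^ 2 + w (j + 1) ^ 2)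

/-- W_j = 1 − ω_j² + (1/2)(ω_{j−1}² + ω_{j+1}²). -/
def WF (ω : ℕ → ℝ → ℝ) (j : ℕ) (r : ℝ) : ℝ := WVal (fun i => ω i r) j

/-- The static spherically symmetric su(N) EYM field equations at radius `r`:
m′ = μG + r²p_θ, S′ = S·(2G/r), and the N−1 Yang–Mills equations
r²μω_j″ + (2m − 2r³p_θ − (2Λ/3)r³)ω_j′ + W_jω_j = 0, with ω₀ ≡ 0, ω_N ≡ 0. -/
def EYM (N : ℕ) (Λ : ℝ) (m S : ℝ → ℝ) (ω : ℕ → ℝ → ℝ) (r : ℝ) : Prop :=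
  ω 0 r = 0 ∧ ω N r = 0 ∧
  HasDerivAt m (muF Λ m r * GF N ω r + r ^ 2 * pTheta N ω r) r ∧
  HasDerivAt S (S r * (2 * GF N ω r / r)) r ∧
  ∀ j ∈ Finset.Icc 1 (N - 1),
    DifferentiableAt ℝ (ω j) r ∧ DifferentiableAt ℝ (deriv (ω j)) r ∧
    r ^ 2 * muF Λ m r * deriv (deriv (ω j)) r
      + (2 * m r - 2 * r ^ 3 * pTheta N ω r - 2 * Λ * r ^ 3 / 3) * deriv (ω j) r
      + WF ω j r * ω j r = 0

/-- Boundary conditions at infinity: m → M, S → 1, ω_j → ω_{j,∞} as r → ∞. -/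
def BCInfinity (N : ℕ) (m S : ℝ → ℝ) (ω : ℕ → ℝ → ℝ) : Prop :=
  (∃ M : ℝ, Tendsto m atTop (𝓝 M)) ∧ Tendsto S atTop (𝓝 1) ∧
  ∀ j ∈ Finset.Icc 1 (N - 1), ∃ w : ℝ, Tendsto (ω j) atTop (𝓝 w)

/-- `f` has exactly `k` zeros in the set `s`. -/
def HasExactlyZeros (f : ℝ → ℝ) (s : Set ℝ) (k : ℕ) : Prop :=
  {r ∈ s | f r = 0}.Finite ∧ {r ∈ s | f r = 0}.ncard = k

/-- The (N−1)×(N−1) matrix A (with 1-based index jᵥ = j+1):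
A_{i,j} = 2jᵥ(N−jᵥ) if i = j, −jᵥ(N−jᵥ) if |i−j| = 1, 0 otherwise. -/
def matA (N : ℕ) : Matrix (Fin (N - 1)) (Fin (N - 1)) ℝ :=
  Matrix.of fun i j =>
    if i = j then 2 * (((j : ℕ) + 1 : ℝ) * ((N : ℝ) - ((j : ℕ) + 1)))
    else if (i : ℕ) + 1 = (j : ℕ) ∨ (j : ℕ) + 1 = (i : ℕ) then
      -(((j : ℕ) + 1 : ℝ) * ((N : ℝ) - ((j : ℕ) + 1)))
    else 0

/-- A choice of nonzero eigenvectors v_k of A with eigenvalue k(k−1), where k = i+2. -/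
def IsEigenBasis (N : ℕ) (v : Fin (N - 1) → Fin (N - 1) → ℝ) : Prop :=
  ∀ i : Fin (N - 1), v i ≠ 0 ∧
    (matA N).mulVec (v i) = ((((i : ℕ) + 2) * ((i : ℕ) + 1) : ℕ) : ℝ) • v i

/-- Regularity at the origin with expansion parameters z̄: m(r) = O(r³), S(0) > 0, and
u_j(r) = ω_j(r)/√(j(N−j)) = 1 + Σ_{k=2}^{N} ζ_k(r) (v_k)_j r^k near r = 0, with ζ_k
analytic at 0 and ζ_k(0) = z̄_k (here k = i+2 for i : Fin (N−1)). -/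
def RegularOrigin (N : ℕ) (v : Fin (N - 1) → Fin (N - 1) → ℝ)
    (m S : ℝ → ℝ) (ω : ℕ → ℝ → ℝ) (z : Fin (N - 1) → ℝ) : Prop :=
  (m =O[𝓝[>] (0 : ℝ)] fun r => r ^ 3) ∧ 0 < S 0 ∧
  ∃ δ > 0, ∃ ζ : Fin (N - 1) → ℝ → ℝ,
    (∀ i, AnalyticAt ℝ (ζ i) 0 ∧ ζ i 0 = z i) ∧
    ∀ j : Fin (N - 1), ∀ r ∈ Set.Ioo (0 : ℝ) δ,
      ω ((j : ℕ) + 1) r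
        = Real.sqrt (((j : ℕ) + 1 : ℝ) * ((N : ℝ) - ((j : ℕ) + 1)))
          * (1 + ∑ i : Fin (N - 1), ζ i r * v i j * r ^ ((i : ℕ) + 2))


/-- The operator `f ↦ (s ↦ ∫₀¹ tⁿ f(ts) dt)`, inverse to `s d/ds + (n + 1)` on `C([0,1])`. -/
def radialMean (n : ℕ) : C(unitInterval, ℝ) →L[ℝ] C(unitInterval, ℝ) :=
  LinearMap.mkContinuous
    { toFun := fun f =>
        ⟨fun s => ∫ t in (0 : ℝ)..1, t ^ n * Set.IccExtend zero_le_one f (t * s), by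
          refine intervalIntegral.continuous_parametric_intervalIntegral_of_continuous' ?_ 0 1
          have := f.continuous.Icc_extend' (h := zero_le_one)
          simp only [Function.uncurry_def]
          fun_prop⟩
      map_add' := fun f g => by
        ext s
        have hf := f.continuous.Icc_extend' (h := zero_le_one)
        have hg := g.continuous.Icc_extend' (h := zero_le_one)
        simp only [ContinuousMap.coe_mk, ContinuousMap.add_apply]
        rw [← intervalIntegral.integral_add]
        · simp [Set.IccExtend, mul_add]
        · exact Continuous.intervalIntegrable (by fun_prop) _ _
        · exact Continuous.intervalIntegrable (by fun_prop) _ _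
      map_smul' := fun c f => by
        ext s
        simp only [ContinuousMap.coe_mk, ContinuousMap.smul_apply, RingHom.id_apply, smul_eq_mul]
        rw [← intervalIntegral.integral_const_mul]
        simp [Set.IccExtend, mul_left_comm] }
    1 fun f => by
      rw [one_mul, ContinuousMap.norm_le _ (norm_nonneg f)]
      intro s
      have := intervalIntegral.norm_integral_le_of_norm_le_const (a := 0) (b := 1) (C := ‖f‖)
        (f := fun t : ℝ => t ^ n * Set.IccExtend zero_le_one f (t * s)) fun t ht => by
          rw [Set.uIoc_of_le zero_le_one] at ht
          rw [norm_mul]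
          calc _ ≤ 1 * ‖f‖ := by
                gcongr
                · rw [norm_pow, Real.norm_of_nonneg ht.1.le]
                  exact pow_le_one₀ ht.1.le ht.2
                · exact f.norm_coe_le_norm _
            _ = ‖f‖ := one_mul _
      simpa using this

theorem radialMean_apply (n : ℕ) (f : C(unitInterval, ℝ)) (s : unitInterval) :
    radialMean n f s = ∫ t in (0 : ℝ)..1, t ^ n * Set.IccExtend zero_le_one f (t * s) := rfl

/-- The dilation `f ↦ f(s ·)` of a function on the unit interval. -/
def dilate (s : unitInterval) : C(unitInterval, ℝ) →ₐ[ℝ] C(unitInterval, ℝ) :=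
  ContinuousMap.compRightAlgHom ℝ ℝ ⟨fun t => s * t, by fun_prop⟩

theorem dilate_apply (s : unitInterval) (f : C(unitInterval, ℝ)) (t : unitInterval) :
    dilate s f t = f (s * t) := rfl

theorem norm_dilate_le (s : unitInterval) (f : C(unitInterval, ℝ)) : ‖dilate s f‖ ≤ ‖f‖ :=
  (ContinuousMap.norm_le _ (norm_nonneg f)).2 fun t => f.norm_coe_le_norm (s * t)

theorem radialMean_dilate (n : ℕ) (s : unitInterval) (f : C(unitInterval, ℝ)) :
    radialMean n (dilate s f) = dilate s (radialMean n f) := by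
  ext t
  rw [dilate_apply, radialMean_apply, radialMean_apply]
  refine intervalIntegral.integral_congr fun u hu => ?_
  rw [Set.uIcc_of_le zero_le_one] at hu
  have h1 : u * (t : ℝ) ∈ Set.Icc (0 : ℝ) 1 := (⟨u, hu⟩ * t : unitInterval).2
  have h2 : u * ((s * t : unitInterval) : ℝ) ∈ Set.Icc (0 : ℝ) 1 :=
    (⟨u, hu⟩ * (s * t) : unitInterval).2
  rw [Set.IccExtend_of_mem _ _ h1, Set.IccExtend_of_mem _ _ h2, dilate_apply]
  congr 2
  ext
  simp only [Set.Icc.coe_mul]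
  ring

theorem pow_mul_radialMean (n : ℕ) (f : C(unitInterval, ℝ)) {s : ℝ} (hs : s ∈ Set.Ioo (0 : ℝ) 1) :
    s ^ (n + 1) * Set.IccExtend zero_le_one (radialMean n f) s
      = ∫ t in (0 : ℝ)..s, t ^ n * Set.IccExtend zero_le_one f t := by
  rw [Set.IccExtend_of_mem _ _ ⟨hs.1.le, hs.2.le⟩, radialMean_apply]
  have h := intervalIntegral.mul_integral_comp_mul_right (a := 0) (b := 1) s
    (f := fun t => t ^ n * Set.IccExtend zero_le_one f t)
  simp only [zero_mul, one_mul] at h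
  rw [← h, pow_succ', mul_assoc, ← intervalIntegral.integral_const_mul]
  simp only [mul_pow, mul_left_comm, mul_assoc]

theorem hasDerivAt_radialMean (n : ℕ) (f : C(unitInterval, ℝ)) {s : ℝ}
    (hs : s ∈ Set.Ioo (0 : ℝ) 1) :
    HasDerivAt (Set.IccExtend zero_le_one (radialMean n f))
      ((Set.IccExtend zero_le_one f s
        - (n + 1) * Set.IccExtend zero_le_one (radialMean n f) s) / s) s := by
  have hf := f.continuous.Icc_extend' (h := zero_le_one)
  have hc : Continuous fun t : ℝ => t ^ n * Set.IccExtend zero_le_one f t := by fun_prop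
  have hprim := intervalIntegral.integral_hasDerivAt_right (hc.intervalIntegrable 0 s)
    hc.stronglyMeasurable.stronglyMeasurableAtFilter hc.continuousAt
  have hs0 : s ≠ 0 := hs.1.ne'
  have hquot := hprim.div (hasDerivAt_pow (n + 1) s) (pow_ne_zero _ hs0)
  refine (hquot.congr_deriv ?_).congr_of_eventuallyEq ?_
  · rw [← pow_mul_radialMean n f hs]
    field_simp
    push_cast
    ring
  · filter_upwards [isOpen_Ioo.mem_nhds hs] with t ht
    have := pow_mul_radialMean n f ht
    rw [Pi.div_apply, ← this, mul_div_cancel_left₀ _ (pow_ne_zero _ ht.1.ne')]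

/-- The analytic implicit function theorem for a fixed-point equation `u = R (q, u)` whose
right-hand side vanishes to second order at the origin. -/
theorem exists_analytic_fixedPoint {Q E : Type*} [NormedAddCommGroup Q] [NormedSpace ℝ Q]
    [CompleteSpace Q] [NormedAddCommGroup E] [NormedSpace ℝ E] [CompleteSpace E]
    {R : Q × E → E} (hRan : AnalyticAt ℝ R 0) (hR0 : R 0 = 0)
    (hRd : HasFDerivAt R (0 : Q × E →L[ℝ] E) 0) :
    ∃ δ > 0, ∃ ρ > 0, ∃ φ : Q → E,
      (∀ q, ‖q‖ < δ → AnalyticAt ℝ φ q ∧ φ q = R (q, φ q) ∧ ‖φ q‖ < ρ) ∧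
      ∀ q u, ‖q‖ < δ → ‖u‖ < ρ → u = R (q, u) → u = φ q := by
  let Ψ : Q × E → Q × E := fun q => (q.1, q.2 - R q)
  have hΨan : AnalyticAt ℝ Ψ 0 := analyticAt_fst.prod (analyticAt_snd.sub hRan)
  have hΨd : HasFDerivAt Ψ ((ContinuousLinearEquiv.refl ℝ (Q × E) : Q × E →L[ℝ] Q × E)) 0 := by
    have h := (hasFDerivAt_fst (𝕜 := ℝ) (p := (0 : Q × E))).prodMk
      ((hasFDerivAt_snd (𝕜 := ℝ) (p := (0 : Q × E))).sub hRd)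
    refine h.congr_fderiv ?_
    ext <;> simp
  have hΨs : HasStrictFDerivAt Ψ ((ContinuousLinearEquiv.refl ℝ (Q × E) : Q × E →L[ℝ] Q × E)) 0 :=
    hΨd.fderiv ▸ hΨan.hasStrictFDerivAt
  let e := hΨs.toOpenPartialHomeomorph Ψ
  have he : ∀ q, e q = Ψ q := fun _ => rfl
  have h0 : (0 : Q × E) ∈ e.source := hΨs.mem_toOpenPartialHomeomorph_source
  have hΨ0 : Ψ 0 = 0 := by
    change ((0 : Q × E).1, (0 : Q × E).2 - R 0) = 0
    rw [hR0]; simp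
  have hsymm0 : e.symm 0 = 0 := by
    have := e.left_inv h0
    rwa [he, hΨ0] at this
  have h0t : (0 : Q × E) ∈ e.target := by
    have := e.map_source h0
    rwa [he, hΨ0] at this
  have hsymm : AnalyticAt ℝ e.symm 0 := by
    refine e.analyticAt_symm (i := ContinuousLinearEquiv.refl ℝ (Q × E)) h0t ?_ ?_
    · rw [hsymm0]; exact hΨan
    · rw [hsymm0]; exact hΨd.fderiv
  let φ : Q → E := fun q => (e.symm (q, 0)).2
  have hφ : AnalyticAt ℝ φ 0 :=
    analyticAt_snd.comp (AnalyticAt.comp (g := e.symm) (f := fun q : Q => (q, (0 : E))) hsymm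
      (analyticAt_id.prod analyticAt_const))
  have hφ0 : φ 0 = 0 := congrArg Prod.snd hsymm0
  obtain ⟨ρ, hρ, hρs⟩ := Metric.mem_nhds_iff.1 (e.open_source.mem_nhds h0)
  have hev : ∀ᶠ q in 𝓝 (0 : Q), (AnalyticAt ℝ φ q ∧ ‖φ q‖ < ρ) ∧
      ((q, 0) : Q × E) ∈ e.target ∧ ‖q‖ < ρ := by
    refine (hφ.eventually_analyticAt.and ?_).and (Eventually.and ?_ ?_)
    · have := hφ.continuousAt.norm
      refine this.eventually_lt_const ?_
      simpa [hφ0] using hρ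
    · have hc : ContinuousAt (fun q : Q => ((q, 0) : Q × E)) 0 := by fun_prop
      exact hc.preimage_mem_nhds (e.open_target.mem_nhds h0t)
    · have : ContinuousAt (fun q : Q => ‖q‖) 0 := by fun_prop
      refine this.eventually_lt_const ?_
      simpa using hρ
  obtain ⟨δ, hδ, hball⟩ := Metric.eventually_nhds_iff.1 hev
  simp only [dist_zero_right] at hball
  have hsol : ∀ q, ‖q‖ < δ → e.symm (q, 0) = (q, φ q) ∧ φ q = R (q, φ q) := fun q hq => by
    have h1 : Ψ (e.symm (q, 0)) = (q, 0) := e.right_inv (hball hq).2.1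
    have h1' : (Ψ (e.symm (q, 0))).1 = q := congrArg Prod.fst h1
    have h2 : e.symm (q, 0) = (q, φ q) := Prod.ext h1' rfl
    rw [h2] at h1
    exact ⟨h2, sub_eq_zero.1 (congrArg Prod.snd h1)⟩
  refine ⟨δ, hδ, ρ, hρ, φ, fun q hq => ⟨(hball hq).1.1, (hsol q hq).2, (hball hq).1.2⟩,
    fun q u hq hu hfix => ?_⟩
  have hmem : (q, u) ∈ e.source := hρs (by
    rw [mem_ball_zero_iff, Prod.norm_def]
    exact max_lt (hball hq).2.2 hu)
  have h3 : e (q, u) = (q, 0) := Prod.ext rfl (sub_eq_zero.2 hfix)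
  have h4 := e.left_inv hmem
  rw [h3, (hsol q hq).1] at h4
  exact (congrArg Prod.snd h4).symm

section Fuchsian

variable {ι L : Type*}

/-- The arguments (independent variable, parameters, unknowns) of the right-hand sides of a
Fuchsian system, as functions on the unit interval: the independent variable is `r s`. -/
def jet (q : ((ι → ℝ) × ℝ) × (L → C(unitInterval, ℝ))) : Option ι ⊕ L → C(unitInterval, ℝ) :=
  Sum.elim (fun o => o.elim (q.1.2 • ⟨fun s => (s : ℝ), by fun_prop⟩)
    fun i => algebraMap ℝ C(unitInterval, ℝ) (q.1.1 i)) q.2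

/-- The arguments of the right-hand sides of a Fuchsian system at a point. -/
def jetAt (p : ι → ℝ) (r : ℝ) (y : L → ℝ) : Option ι ⊕ L → ℝ :=
  Sum.elim (fun o => o.elim r p) y

theorem jet_apply (q : ((ι → ℝ) × ℝ) × (L → C(unitInterval, ℝ))) (s : unitInterval)
    (x : Option ι ⊕ L) :
    jet q x s = jetAt q.1.1 (q.1.2 * s) (fun l => q.2 l s) x := by
  rcases x with (_ | i) | l
  · rfl
  · simp [jet, jetAt]
  · rfl

theorem aeval_jet_apply (q : ((ι → ℝ) × ℝ) × (L → C(unitInterval, ℝ))) (s : unitInterval)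
    (P : MvPolynomial (Option ι ⊕ L) ℝ) :
    MvPolynomial.aeval (jet q) P s
      = MvPolynomial.aeval (jetAt q.1.1 (q.1.2 * s) (fun l => q.2 l s)) P := by
  rw [← funext (jet_apply q s)]
  exact MvPolynomial.comp_aeval_apply (jet q) (ContinuousMap.evalAlgHom ℝ ℝ s) P

theorem dilate_jet (p : ι → ℝ) (r : ℝ) (U : L → C(unitInterval, ℝ)) (s : unitInterval) :
    (fun x => dilate s (jet ((p, r), U) x)) = jet ((p, r * s), fun l => dilate s (U l)) := by
  funext x
  ext t
  rw [dilate_apply, jet_apply, jet_apply]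
  simp [dilate_apply, mul_assoc]

theorem jet_zero : jet (0 : ((ι → ℝ) × ℝ) × (L → C(unitInterval, ℝ))) = 0 := by
  funext x
  ext s
  rcases x with (_ | i) | l <;> simp [jet]

variable [Fintype ι] [Fintype L]

theorem analyticAt_jet (x : Option ι ⊕ L) (q : ((ι → ℝ) × ℝ) × (L → C(unitInterval, ℝ))) :
    AnalyticAt ℝ (fun q => jet q x) q := by
  rcases x with (_ | i) | l
  · have h : AnalyticAt ℝ (fun q : ((ι → ℝ) × ℝ) × (L → C(unitInterval, ℝ)) => q.1.2) q :=
      analyticAt_snd.comp analyticAt_fst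
    exact h.smul analyticAt_const
  · have h : AnalyticAt ℝ (fun q : ((ι → ℝ) × ℝ) × (L → C(unitInterval, ℝ)) => q.1.1 i) q :=
      ((ContinuousLinearMap.proj (R := ℝ) (φ := fun _ : ι => ℝ) i).analyticAt _).comp
        (analyticAt_fst.comp analyticAt_fst)
    have := h.smul (analyticAt_const (v := (1 : C(unitInterval, ℝ))))
    refine this.congr (Eventually.of_forall fun q => ?_)
    exact (Algebra.algebraMap_eq_smul_one (A := C(unitInterval, ℝ)) (q.1.1 i)).symm
  · exact ((ContinuousLinearMap.proj (R := ℝ) (φ := fun _ : L => C(unitInterval, ℝ)) l).analyticAt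
      _).comp analyticAt_snd

/-- A polynomial without terms of degree less than two has zero value and derivative at `0`. -/
theorem hasFDerivAt_aeval_jet {P : MvPolynomial (Option ι ⊕ L) ℝ}
    (hP : P ∈ RingHom.ker (MvPolynomial.constantCoeff (σ := Option ι ⊕ L) (R := ℝ)) ^ 2) :
    MvPolynomial.aeval (R := ℝ) (jet (0 : ((ι → ℝ) × ℝ) × (L → C(unitInterval, ℝ)))) P = 0 ∧
    HasFDerivAt (𝕜 := ℝ) (fun q : ((ι → ℝ) × ℝ) × (L → C(unitInterval, ℝ)) =>
      MvPolynomial.aeval (R := ℝ) (jet q) P) 0 0 := by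
  rw [pow_two] at hP
  have key : ∀ a ∈ RingHom.ker (MvPolynomial.constantCoeff (σ := Option ι ⊕ L) (R := ℝ)),
      MvPolynomial.aeval (R := ℝ) (jet (0 : ((ι → ℝ) × ℝ) × (L → C(unitInterval, ℝ)))) a = 0 := by
    intro a ha
    rw [RingHom.mem_ker] at ha
    rw [jet_zero, MvPolynomial.aeval_zero, ha, map_zero]
  induction hP using Submodule.mul_induction_on' with
  | mem_mul_mem a ha b hb =>
    refine ⟨by rw [map_mul, key a ha, zero_mul], ?_⟩
    have hda := (AnalyticAt.aeval_mvPolynomial (fun x => analyticAt_jet x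
      (0 : ((ι → ℝ) × ℝ) × (L → C(unitInterval, ℝ)))) a).differentiableAt.hasFDerivAt
    have hdb := (AnalyticAt.aeval_mvPolynomial (fun x => analyticAt_jet x
      (0 : ((ι → ℝ) × ℝ) × (L → C(unitInterval, ℝ)))) b).differentiableAt.hasFDerivAt
    simp only [map_mul]
    refine (hda.mul hdb).congr_fderiv ?_
    rw [key a ha, key b hb, zero_smul, zero_smul, add_zero]
  | add a ha b hb iha ihb =>
    refine ⟨by rw [map_add, iha.1, ihb.1, add_zero], ?_⟩
    simp only [map_add]
    exact (iha.2.add ihb.2).congr_fderiv (add_zero _)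

/-- Analytic solvability of `U = T (P(r s, p, U))` on the unit interval near the origin, for
polynomials `P` vanishing to second order and operators `T` commuting with dilations. -/
theorem exists_analytic_dilation_solution
    (P : L → MvPolynomial (Option ι ⊕ L) ℝ)
    (hP : ∀ l, P l ∈ RingHom.ker (MvPolynomial.constantCoeff (σ := Option ι ⊕ L) (R := ℝ)) ^ 2)
    (T : L → C(unitInterval, ℝ) →L[ℝ] C(unitInterval, ℝ))
    (hT : ∀ l s f, T l (dilate s f) = dilate s (T l f)) :
    ∃ δ > 0, ∃ y : (ι → ℝ) × ℝ → L → ℝ,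
      (∀ q, ‖q‖ < δ → ∀ l, AnalyticAt ℝ (fun q => y q l) q) ∧
      ∀ p r, ‖p‖ < δ → 0 ≤ r → r < δ → ∃ Y : L → C(unitInterval, ℝ),
        (∀ l, Y l = T l (MvPolynomial.aeval (jet ((p, r), Y)) (P l))) ∧
        ∀ l (s : unitInterval), Y l s = y (p, r * s) l := by
  let R : ((ι → ℝ) × ℝ) × (L → C(unitInterval, ℝ)) → (L → C(unitInterval, ℝ)) :=
    fun q l => T l (MvPolynomial.aeval (jet q) (P l))
  have hRan : AnalyticAt ℝ R 0 := AnalyticAt.pi fun l =>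
    ((T l).analyticAt _).comp (AnalyticAt.aeval_mvPolynomial (fun x => analyticAt_jet x 0) (P l))
  have hR0 : R 0 = 0 := by
    funext l
    change T l (MvPolynomial.aeval (jet 0) (P l)) = 0
    rw [(hasFDerivAt_aeval_jet (hP l)).1, map_zero]
  have hRd : HasFDerivAt (𝕜 := ℝ) R 0 0 := by
    rw [hasFDerivAt_pi']
    intro l
    have := (T l).hasFDerivAt.comp 0 (hasFDerivAt_aeval_jet (hP l)).2
    refine this.congr_fderiv ?_
    ext <;> simp
  obtain ⟨δ, hδ, ρ, hρ, φ, hφ, huniq⟩ := exists_analytic_fixedPoint hRan hR0 hRd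
  refine ⟨δ, hδ, fun q l => φ q l 1, fun q hq l => ?_, fun p r hp hr hrδ => ?_⟩
  · exact (((ContinuousMap.evalCLM ℝ (1 : unitInterval)).comp (ContinuousLinearMap.proj (R := ℝ)
      (φ := fun _ : L => C(unitInterval, ℝ)) l)).analyticAt _).comp (hφ q hq).1
  · have hnorm : ∀ s : unitInterval, ‖(p, r * s)‖ < δ := fun s => by
      rw [Prod.norm_def]
      refine max_lt hp ?_
      rw [Real.norm_of_nonneg (mul_nonneg hr s.2.1)]
      exact (mul_le_of_le_one_right hr s.2.2).trans_lt hrδ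
    have hnr : ‖(p, r)‖ < δ := by simpa using hnorm 1
    have hYfix : ∀ l, φ (p, r) l = T l (MvPolynomial.aeval (jet ((p, r), φ (p, r))) (P l)) :=
      fun l => congrFun (hφ _ hnr).2.1 l
    refine ⟨φ (p, r), hYfix, fun l s => ?_⟩
    have hdil : (fun l => dilate s (φ (p, r) l)) = φ (p, r * s) := by
      refine huniq _ _ (hnorm s) (lt_of_le_of_lt ?_ (hφ _ hnr).2.2) ?_
      · refine (pi_norm_le_iff_of_nonneg (norm_nonneg _)).2 fun l => ?_
        exact (norm_dilate_le s _).trans (norm_le_pi_norm (φ (p, r)) l)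
      · funext l
        change _ = T l (MvPolynomial.aeval (jet _) (P l))
        rw [← dilate_jet]
        conv_lhs => rw [hYfix l, ← hT, MvPolynomial.comp_aeval_apply]
    simp only [← hdil, dilate_apply, mul_one]

end Fuchsian

/-- The weight `j (N - j)`. -/
def weight (N : ℕ) (x : ℝ) : ℝ := x * (N - x)

theorem matA_mulVec (N : ℕ) (f : ℕ → ℝ) (i : Fin (N - 1)) :
    (matA N).mulVec (fun j => f (j + 1)) i
      = 2 * weight N ((i : ℕ) + 1 : ℕ) * f (i + 1) - weight N (i : ℕ) * f i
        - weight N ((i : ℕ) + 2 : ℕ) * f (i + 2) := by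
  obtain ⟨i, hi⟩ := i
  let g : ℕ → ℝ := fun j => weight N (j + 1 : ℕ) * f (j + 1)
  have hterm : ∀ j : Fin (N - 1), matA N ⟨i, hi⟩ j * f (j + 1)
      = (if i = (j : ℕ) then 2 * g j else 0) - (if i + 1 = (j : ℕ) then g j else 0)
        - (if (j : ℕ) + 1 = i then g j else 0) := by
    intro j
    simp only [matA, Matrix.of_apply, Fin.ext_iff, g, weight]
    split_ifs <;> first | omega | (push_cast; ring)
  simp only [Matrix.mulVec, dotProduct, hterm]
  rw [Fin.sum_univ_eq_sum_range (fun j => (if i = j then 2 * g j else 0)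
    - (if i + 1 = j then g j else 0) - (if j + 1 = i then g j else 0)),
    Finset.sum_sub_distrib, Finset.sum_sub_distrib, Finset.sum_ite_eq, Finset.sum_ite_eq,
    if_pos (Finset.mem_range.2 hi)]
  have h2 : (if i + 1 ∈ Finset.range (N - 1) then g (i + 1) else 0)
      = weight N (i + 2 : ℕ) * f (i + 2) := by
    split_ifs with h
    · rfl
    · have : N = i + 2 := by rw [Finset.mem_range] at h; omega
      simp [weight, this]
  have h3 : (∑ j ∈ Finset.range (N - 1), if j + 1 = i then g j else 0) = weight N i * f i := by
    rcases i with _ | k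
    · simp [weight]
    · simp only [Nat.add_right_cancel_iff, Finset.sum_ite_eq']
      rw [if_pos (Finset.mem_range.2 (by omega))]
  rw [h2, h3]
  simp only [g]
  ring

/-- The rising factorial `(x + 1) ⋯ (x + d)`. -/
def risingFac (d : ℕ) (x : ℝ) : ℝ := ∏ l ∈ Finset.range d, (x + 1 + l)

theorem risingFac_succ (d : ℕ) (x : ℝ) :
    risingFac (d + 1) x = risingFac d x * (x + 1 + d) := Finset.prod_range_succ _ _

theorem risingFac_succ' (d : ℕ) (x : ℝ) :
    risingFac (d + 1) x = risingFac d (x + 1) * (x + 1) := by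
  simp only [risingFac, Finset.prod_range_succ', Nat.cast_zero, add_zero]
  congr 1
  refine Finset.prod_congr rfl fun l _ => ?_
  push_cast
  ring

theorem weight_second_difference (N d : ℕ) (x : ℝ) :
    2 * weight N (x + 1) * risingFac (d + 1) (x + 1) - weight N x * risingFac (d + 1) x
        - weight N (x + 2) * risingFac (d + 1) (x + 2)
      = (d + 3) * (d + 2) * risingFac (d + 1) (x + 1)
        - (N + d + 2) * (d + 2) * (d + 1) * risingFac d (x + 1) := by
  have h1 := risingFac_succ' d x
  have h2 := risingFac_succ d (x + 1)
  have h3 := risingFac_succ' (d + 1) (x + 1)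
  rw [risingFac_succ (d + 1), show x + 1 + 1 = x + 2 by ring] at h3
  have h4 : weight N (x + 2) * risingFac (d + 1) (x + 2)
      = (N - (x + 2)) * (risingFac (d + 1) (x + 1) * (x + 2 + (d + 1 : ℕ))) := by
    rw [h3, weight]; ring
  rw [h4, h1, h2]
  simp only [weight]
  push_cast
  ring

/-- Rising factorials as vectors. -/
def risingVec (N d : ℕ) : Fin (N - 1) → ℝ := fun j => risingFac d ((j : ℕ) + 1 : ℕ)

/-- Vectors that are polynomials of degree less than `d` in the index. -/
def polyVec (N d : ℕ) : Submodule ℝ (Fin (N - 1) → ℝ) :=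
  Submodule.span ℝ {f | ∃ i < d, f = risingVec N i}

theorem risingVec_mem {N d i : ℕ} (h : i < d) : risingVec N i ∈ polyVec N d :=
  Submodule.subset_span ⟨i, h, rfl⟩

theorem polyVec_mono {N d e : ℕ} (h : d ≤ e) : polyVec N d ≤ polyVec N e :=
  Submodule.span_mono fun _ ⟨i, hi, hf⟩ => ⟨i, hi.trans_le h, hf⟩

theorem matA_mulVec_risingVec_zero (N : ℕ) :
    (matA N).mulVec (risingVec N 0) = (2 : ℝ) • risingVec N 0 := by
  funext i
  refine (matA_mulVec N (fun k => risingFac 0 k) i).trans ?_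
  simp [risingVec, risingFac, weight]
  ring

theorem matA_mulVec_risingVec_succ (N d : ℕ) :
    (matA N).mulVec (risingVec N (d + 1)) = ((d + 3) * (d + 2) : ℝ) • risingVec N (d + 1)
      - ((N + d + 2) * (d + 2) * (d + 1) : ℝ) • risingVec N d := by
  funext i
  refine (matA_mulVec N (fun k => risingFac (d + 1) k) i).trans ?_
  have := weight_second_difference N d (i : ℕ)
  simp only [Pi.sub_apply, Pi.smul_apply, smul_eq_mul, risingVec]
  push_cast
  exact this

theorem matA_sub_mem {N d : ℕ} {f : Fin (N - 1) → ℝ} (hf : f ∈ polyVec N (d + 1)) :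
    (matA N).mulVec f - ((d + 2) * (d + 1) : ℝ) • f ∈ polyVec N d := by
  induction hf using Submodule.span_induction with
  | mem f hf =>
    obtain ⟨i, hi, rfl⟩ := hf
    rcases i with _ | i
    · rw [matA_mulVec_risingVec_zero]
      rcases d with _ | d
      · norm_num
      · exact Submodule.sub_mem _ (Submodule.smul_mem _ _ (risingVec_mem d.succ_pos))
          (Submodule.smul_mem _ _ (risingVec_mem d.succ_pos))
    · rw [matA_mulVec_risingVec_succ]
      have hd : risingVec N i ∈ polyVec N d := risingVec_mem (by omega)
      rcases eq_or_ne (i + 1) d with h | h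
      · subst h
        push_cast
        rw [show ((i : ℝ) + 1 + 2) * (i + 1 + 1) = (i + 3) * (i + 2) by ring, sub_sub_cancel_left]
        exact Submodule.neg_mem _ (Submodule.smul_mem _ _ hd)
      · have hd' : risingVec N (i + 1) ∈ polyVec N d := risingVec_mem (by omega)
        exact Submodule.sub_mem _ (Submodule.sub_mem _ (Submodule.smul_mem _ _ hd')
          (Submodule.smul_mem _ _ hd)) (Submodule.smul_mem _ _ hd')
  | zero => simp
  | add f g _ _ hf hg =>
    rw [Matrix.mulVec_add, smul_add, add_sub_add_comm]
    exact Submodule.add_mem _ hf hg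
  | smul c f _ hf =>
    rw [Matrix.mulVec_smul, smul_comm, ← smul_sub]
    exact Submodule.smul_mem _ _ hf

theorem index_mul_mem {N d : ℕ} {f : Fin (N - 1) → ℝ} (hf : f ∈ polyVec N d) :
    (fun j : Fin (N - 1) => (((j : ℕ) + 1 : ℕ) : ℝ) * f j) ∈ polyVec N (d + 1) := by
  induction hf using Submodule.span_induction with
  | mem f hf =>
    obtain ⟨i, hi, rfl⟩ := hf
    have : (fun j : Fin (N - 1) => (((j : ℕ) + 1 : ℕ) : ℝ) * risingVec N i j)
        = risingVec N (i + 1) - ((i : ℝ) + 1) • risingVec N i := by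
      funext j
      simp only [risingVec, risingFac_succ, Pi.sub_apply, Pi.smul_apply, smul_eq_mul]
      ring
    rw [this]
    exact Submodule.sub_mem _ (risingVec_mem (by omega))
      (Submodule.smul_mem _ _ (risingVec_mem (by omega)))
  | zero =>
    simp only [Pi.zero_apply, mul_zero]
    exact Submodule.zero_mem _
  | add f g _ _ hf hg =>
    convert Submodule.add_mem _ hf hg using 1
    funext j
    simp [mul_add]
  | smul c f _ hf =>
    convert Submodule.smul_mem _ c hf using 1
    funext j
    simp [mul_left_comm]

theorem risingVec_mul_mem {N d : ℕ} (a : ℕ) {f : Fin (N - 1) → ℝ} (hf : f ∈ polyVec N d) :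
    risingVec N a * f ∈ polyVec N (a + d) := by
  induction a with
  | zero =>
    have : risingVec N 0 = 1 := by funext j; simp [risingVec, risingFac]
    rwa [this, one_mul, zero_add]
  | succ a ih =>
    have : risingVec N (a + 1) * f
        = (fun j : Fin (N - 1) => (((j : ℕ) + 1 : ℕ) : ℝ) * (risingVec N a * f) j) + ((a : ℝ) + 1) • (risingVec N a * f) := by
      funext j
      simp only [risingVec, risingFac_succ, Pi.add_apply, Pi.mul_apply, Pi.smul_apply, smul_eq_mul]
      ring
    rw [this, show a + 1 + d = a + d + 1 by ring]
    exact Submodule.add_mem _ (index_mul_mem ih)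
      (Submodule.smul_mem _ _ (polyVec_mono (Nat.le_succ _) ih))

theorem polyVec_mul_mem {N a d : ℕ} {f g : Fin (N - 1) → ℝ} (hf : f ∈ polyVec N (a + 1))
    (hg : g ∈ polyVec N d) : f * g ∈ polyVec N (a + d) := by
  induction hf using Submodule.span_induction with
  | mem f hf =>
    obtain ⟨i, hi, rfl⟩ := hf
    exact polyVec_mono (by omega) (risingVec_mul_mem i hg)
  | zero => simp
  | add f f' _ _ hf hf' => rw [add_mul]; exact Submodule.add_mem _ hf hf'
  | smul c f _ hf => rw [smul_mul_assoc]; exact Submodule.smul_mem _ _ hf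

theorem exists_mem_polyVec (N : ℕ) (f : Fin (N - 1) → ℝ) : ∃ d, f ∈ polyVec N d := by
  have key : ∀ q : Polynomial ℝ, ∃ d,
      (fun j : Fin (N - 1) => q.eval (((j : ℕ) + 1 : ℕ) : ℝ)) ∈ polyVec N d := by
    intro q
    induction q using Polynomial.induction_on' with
    | add p q hp hq =>
      obtain ⟨d, hd⟩ := hp
      obtain ⟨e, he⟩ := hq
      refine ⟨max d e, ?_⟩
      simp only [Polynomial.eval_add]
      exact Submodule.add_mem _ (polyVec_mono (le_max_left _ _) hd)
        (polyVec_mono (le_max_right _ _) he)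
    | monomial n c =>
      refine ⟨n + 1, ?_⟩
      simp only [Polynomial.eval_monomial]
      refine Submodule.smul_mem _ c (x := fun j : Fin (N - 1) => (((j : ℕ) + 1 : ℕ) : ℝ) ^ n) ?_
      induction n with
      | zero =>
        convert risingVec_mem (N := N) (Nat.lt_succ_self 0) using 1
        funext j
        simp [risingVec, risingFac]
      | succ n ih => simpa only [pow_succ'] using index_mul_mem ih
  obtain ⟨d, hd⟩ := key (Lagrange.interpolate Finset.univ
    (fun j : Fin (N - 1) => (((j : ℕ) + 1 : ℕ) : ℝ)) f)
  refine ⟨d, ?_⟩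
  convert hd using 1
  funext j
  refine (Lagrange.eval_interpolate_at_node (v := fun j : Fin (N - 1) => (((j : ℕ) + 1 : ℕ) : ℝ))
    f ?_ (Finset.mem_univ j)).symm
  intro a _ b _ hab
  have : (a : ℕ) + 1 = (b : ℕ) + 1 := Nat.cast_injective (R := ℝ) hab
  exact Fin.ext (by omega)

theorem eigenvector_mem_polyVec {N : ℕ} {v : Fin (N - 1) → Fin (N - 1) → ℝ}
    (hv : IsEigenBasis N v) (i : Fin (N - 1)) : v i ∈ polyVec N (i + 1) := by
  obtain ⟨d, hd⟩ := exists_mem_polyVec N (v i)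
  induction d with
  | zero => exact polyVec_mono (Nat.zero_le _) hd
  | succ d ih =>
    rcases le_or_gt d (i : ℕ) with h | h
    · exact polyVec_mono (by omega) hd
    · refine ih ?_
      have hm := matA_sub_mem hd
      rw [(hv i).2, ← sub_smul] at hm
      refine (Submodule.smul_mem_iff _ ?_).1 hm
      rw [sub_ne_zero]
      have : ((i : ℕ) + 2) * ((i : ℕ) + 1) < (d + 2) * (d + 1) :=
        Nat.mul_lt_mul'' (by omega) (by omega)
      exact_mod_cast this.ne

/-- Products of eigenvectors expand into eigenvectors, triangularly with respect to the order. -/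
theorem exists_structure_constants {N : ℕ} {v : Fin (N - 1) → Fin (N - 1) → ℝ}
    (hv : IsEigenBasis N v) :
    ∃ C : Fin (N - 1) → Fin (N - 1) → Fin (N - 1) → ℝ,
      (∀ a b c : Fin (N - 1), (a : ℕ) + b < c → C a b c = 0) ∧
      ∀ a b j, v a j * v b j = ∑ c, C a b c * v c j := by
  have hinj : ∀ a b : ℕ, a < b → ((((a + 2) * (a + 1) : ℕ) : ℝ)) ≠ (((b + 2) * (b + 1) : ℕ)) := by
    intro a b hab
    have : (a + 2) * (a + 1) < (b + 2) * (b + 1) := Nat.mul_lt_mul'' (by omega) (by omega)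
    exact_mod_cast this.ne
  have hli : LinearIndependent ℝ v := by
    refine Module.End.eigenvectors_linearIndependent' (matA N).mulVecLin
      (fun i : Fin (N - 1) => ((((i : ℕ) + 2) * ((i : ℕ) + 1) : ℕ) : ℝ)) ?_ v fun i => ?_
    · intro a b hab
      rcases lt_trichotomy (a : ℕ) b with h | h | h
      · exact absurd hab (hinj _ _ h)
      · exact Fin.ext h
      · exact absurd hab.symm (hinj _ _ h)
    · exact ⟨Module.End.mem_eigenspace_iff.2 (hv i).2, (hv i).1⟩
  rcases isEmpty_or_nonempty (Fin (N - 1)) with he | hne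
  · exact ⟨0, fun a => he.elim a, fun a => he.elim a⟩
  let b := basisOfLinearIndependentOfCardEqFinrank hli (by simp)
  have hb : ∀ i, b i = v i := fun i => by simp [b]
  have hA : ∀ f i, b.repr ((matA N).mulVec f) i
      = ((((i : ℕ) + 2) * ((i : ℕ) + 1) : ℕ) : ℝ) * b.repr f i := by
    intro f i
    have : (matA N).mulVec f
        = ∑ k, (b.repr f k * ((((k : ℕ) + 2) * ((k : ℕ) + 1) : ℕ) : ℝ)) • b k := by
      conv_lhs => rw [← b.sum_repr f]
      rw [Matrix.mulVec_sum]
      refine Finset.sum_congr rfl fun k _ => ?_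
      rw [Matrix.mulVec_smul, hb, (hv k).2, smul_smul]
    rw [this, b.repr_sum_self, mul_comm]
  have hzero : ∀ d : ℕ, ∀ f ∈ polyVec N d, ∀ i : Fin (N - 1), d ≤ i → b.repr f i = 0 := by
    intro d
    induction d with
    | zero =>
      intro f hf i _
      have : f = 0 := by simpa [polyVec] using hf
      simp [this]
    | succ d ih =>
      intro f hf i hi
      have h := ih _ (matA_sub_mem hf) i (by omega)
      rw [map_sub, map_smul, Finsupp.sub_apply, Finsupp.smul_apply, hA, smul_eq_mul,
        ← sub_mul] at h
      refine (mul_eq_zero.1 h).resolve_left (sub_ne_zero.2 ?_)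
      have := (hinj d i (by omega)).symm
      push_cast at this ⊢
      exact this
  refine ⟨fun a c k => b.repr (v a * v c) k, fun a c k h => ?_, fun a c j => ?_⟩
  · exact hzero _ _ (polyVec_mul_mem (eigenvector_mem_polyVec hv a) (eigenvector_mem_polyVec hv c)) k
      (by omega)
  · have := congrFun (b.sum_repr (v a * v c)) j
    rw [Finset.sum_apply] at this
    simpa [hb] using this.symm

theorem mul_mem_sq {𝔸 : Type*} [CommRing 𝔸] {I : Ideal 𝔸} {x y : 𝔸} (hx : x ∈ I) (hy : y ∈ I) : x * y ∈ I ^ 2 := by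
  rw [pow_two]
  exact Ideal.mul_mem_mul hx hy

theorem sq_le_self {𝔸 : Type*} [CommRing 𝔸] (I : Ideal 𝔸) : I ^ 2 ≤ I := Ideal.pow_le_self two_ne_zero

section Modes

variable {N : ℕ} {𝔸 𝔹 : Type*} [CommRing 𝔸] [Algebra ℝ 𝔸] [CommRing 𝔹] [Algebra ℝ 𝔹]

/-- The eigenvectors with components indexed from `1`, extended by junk values. -/
def vExt (v : Fin (N - 1) → Fin (N - 1) → ℝ) (i : Fin (N - 1)) (J : ℕ) : ℝ :=
  if h : J - 1 < N - 1 then v i ⟨J - 1, h⟩ else 0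

theorem vExt_succ (v : Fin (N - 1) → Fin (N - 1) → ℝ) (i j : Fin (N - 1)) :
    vExt v i ((j : ℕ) + 1) = v i j := by
  simp [vExt]

/-- The eigenvalue `k (k - 1)`, `k = i + 2`. -/
def eigval (i : Fin (N - 1)) : ℝ := (((i : ℕ) + 2) * ((i : ℕ) + 1) : ℕ)

theorem vExt_eigen {v : Fin (N - 1) → Fin (N - 1) → ℝ} (hv : IsEigenBasis N v)
    (i : Fin (N - 1)) {J : ℕ} (hJ : J ∈ Finset.Icc 1 (N - 1)) :
    2 * weight N J * vExt v i J - weight N (J - 1 : ℕ) * vExt v i (J - 1)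
      - weight N (J + 1 : ℕ) * vExt v i (J + 1) = eigval i * vExt v i J := by
  rw [Finset.mem_Icc] at hJ
  obtain ⟨k, rfl⟩ : ∃ k, J = k + 1 := ⟨J - 1, by omega⟩
  have hk : k < N - 1 := by omega
  have h := matA_mulVec N (vExt v i) ⟨k, hk⟩
  simp only [vExt_succ] at h
  rw [(hv i).2] at h
  simp only [Nat.add_sub_cancel]
  rw [← h, vExt_succ v i ⟨k, hk⟩]
  rfl

theorem vExt_mul {v : Fin (N - 1) → Fin (N - 1) → ℝ}
    {C : Fin (N - 1) → Fin (N - 1) → Fin (N - 1) → ℝ}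
    (hC : ∀ a b j, v a j * v b j = ∑ c, C a b c * v c j) (a b : Fin (N - 1)) (J : ℕ) :
    vExt v a J * vExt v b J = ∑ c, C a b c * vExt v c J := by
  unfold vExt
  split_ifs
  · exact hC a b _
  · simp

/-- The combination `∑ rⁱ ζᵢ vᵢ` of eigenvectors, at the component `j`. -/
def modeSum (v : Fin (N - 1) → Fin (N - 1) → ℝ) (r : 𝔸) (ζ : Fin (N - 1) → 𝔸) (j : ℕ) : 𝔸 :=
  ∑ i, vExt v i j • (r ^ (i : ℕ) * ζ i)

/-- The product of mode coefficients induced by the componentwise product of vectors. -/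
def modeMul (C : Fin (N - 1) → Fin (N - 1) → Fin (N - 1) → ℝ) (r : 𝔸)
    (ζ ξ : Fin (N - 1) → 𝔸) (c : Fin (N - 1)) : 𝔸 :=
  ∑ a, ∑ b, C a b c • (r ^ ((a : ℕ) + b - c) * (ζ a * ξ b))

/-- Mode coefficients of the first derivative of `∑ r^(i+2) ζᵢ vᵢ`, where `ζᵢ' = r κᵢ`. -/
def velocity (r : 𝔸) (ζ κ : Fin (N - 1) → 𝔸) (i : Fin (N - 1)) : 𝔸 :=
  ((i : ℕ) + 2 : ℝ) • ζ i + r ^ 2 * κ i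

/-- Mode coefficients of the second derivative of `∑ r^(i+2) ζᵢ vᵢ`. -/
def acceleration (r : 𝔸) (ζ h : Fin (N - 1) → 𝔸) (i : Fin (N - 1)) : 𝔸 :=
  eigval i • ζ i + r ^ 2 * h i

/-- The kinetic density `G / r²`. -/
def kinetic (v : Fin (N - 1) → Fin (N - 1) → ℝ) (r : 𝔸) (η : Fin (N - 1) → 𝔸) : 𝔸 :=
  ∑ j ∈ Finset.Icc 1 (N - 1), weight N j • modeSum v r η j ^ 2

/-- The quantity `(ω_j² - j (N - j)) / r²` for `b = 1`; in general, the parameter `b` measures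
the strength of the self-interaction of the modes. -/
def sqDefect (v : Fin (N - 1) → Fin (N - 1) → ℝ) (b r : 𝔸) (ζ : Fin (N - 1) → 𝔸) (j : ℕ) : 𝔸 :=
  weight N j • ((2 : ℝ) • modeSum v r ζ j + b * r ^ 2 * modeSum v r ζ j ^ 2)

/-- The tangential pressure in terms of the mode coefficients. -/
def pressure (v : Fin (N - 1) → Fin (N - 1) → ℝ) (b r : 𝔸) (ζ : Fin (N - 1) → 𝔸) : 𝔸 :=
  (1 / 4 : ℝ) • ∑ j ∈ Finset.Icc 1 N, (sqDefect v b r ζ j - sqDefect v b r ζ (j - 1)) ^ 2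

/-- The mode coefficients of half the defects of the squares of the gauge field. -/
def halfDefect (C : Fin (N - 1) → Fin (N - 1) → Fin (N - 1) → ℝ) (b r : 𝔸)
    (ζ : Fin (N - 1) → 𝔸) (i : Fin (N - 1)) : 𝔸 :=
  ζ i + (1 / 2 : ℝ) • (b * r ^ 2 * modeMul C r ζ ζ i)

/-- The right-hand side of the Yang–Mills equations in terms of mode coefficients. -/
def forcing (v : Fin (N - 1) → Fin (N - 1) → ℝ)
    (C : Fin (N - 1) → Fin (N - 1) → Fin (N - 1) → ℝ) (b r Λ B : 𝔸)
    (ζ κ h : Fin (N - 1) → 𝔸) (i : Fin (N - 1)) : 𝔸 :=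
  ((2 : ℝ) • B + (1 / 3 : ℝ) • Λ) * acceleration r ζ h i
    - ((2 : ℝ) • B - (2 : ℝ) • pressure v b r ζ - (2 / 3 : ℝ) • Λ) * velocity r ζ κ i
    + b * ((eigval i / 2) • modeMul C r ζ ζ i
      + modeMul C r ζ (fun k => eigval k • halfDefect C b r ζ k) i)

/-- The right-hand side of the mass equation, divided by `r²`. -/
def massSource (v : Fin (N - 1) → Fin (N - 1) → ℝ) (b r Λ B : 𝔸)
    (ζ κ : Fin (N - 1) → 𝔸) : 𝔸 :=
  (1 - r ^ 2 * ((2 : ℝ) • B + (1 / 3 : ℝ) • Λ)) * kinetic v r (velocity r ζ κ) + pressure v b r ζ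

variable (φ : 𝔸 →ₐ[ℝ] 𝔹) (v : Fin (N - 1) → Fin (N - 1) → ℝ)
  (C : Fin (N - 1) → Fin (N - 1) → Fin (N - 1) → ℝ)

theorem map_modeSum (r : 𝔸) (ζ : Fin (N - 1) → 𝔸) (j : ℕ) :
    φ (modeSum v r ζ j) = modeSum v (φ r) (fun i => φ (ζ i)) j := by
  simp [modeSum]

theorem map_modeMul (r : 𝔸) (ζ ξ : Fin (N - 1) → 𝔸) (c : Fin (N - 1)) :
    φ (modeMul C r ζ ξ c) = modeMul C (φ r) (fun i => φ (ζ i)) (fun i => φ (ξ i)) c := by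
  simp [modeMul]

theorem map_velocity (r : 𝔸) (ζ κ : Fin (N - 1) → 𝔸) (i : Fin (N - 1)) :
    φ (velocity r ζ κ i) = velocity (φ r) (fun i => φ (ζ i)) (fun i => φ (κ i)) i := by
  simp only [velocity, map_add, map_smul, map_mul, map_pow]

theorem map_acceleration (r : 𝔸) (ζ h : Fin (N - 1) → 𝔸) (i : Fin (N - 1)) :
    φ (acceleration r ζ h i) = acceleration (φ r) (fun i => φ (ζ i)) (fun i => φ (h i)) i := by
  simp only [acceleration, map_add, map_smul, map_mul, map_pow]

theorem map_kinetic (r : 𝔸) (η : Fin (N - 1) → 𝔸) :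
    φ (kinetic v r η) = kinetic v (φ r) (fun i => φ (η i)) := by
  simp only [kinetic, map_sum, map_smul, map_pow, map_modeSum]

theorem map_pressure (b r : 𝔸) (ζ : Fin (N - 1) → 𝔸) :
    φ (pressure v b r ζ) = pressure v (φ b) (φ r) (fun i => φ (ζ i)) := by
  simp only [pressure, sqDefect, map_sum, map_smul, map_pow, map_sub, map_add, map_mul,
    map_modeSum]

theorem map_forcing (b r Λ B : 𝔸) (ζ κ h : Fin (N - 1) → 𝔸) (i : Fin (N - 1)) :
    φ (forcing v C b r Λ B ζ κ h i) = forcing v C (φ b) (φ r) (φ Λ) (φ B) (fun i => φ (ζ i))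
      (fun i => φ (κ i)) (fun i => φ (h i)) i := by
  simp only [forcing, halfDefect, map_smul, map_pow, map_sub, map_add, map_mul,
    map_modeMul, map_acceleration, map_velocity, map_pressure]

theorem map_massSource (b r Λ B : 𝔸) (ζ κ : Fin (N - 1) → 𝔸) :
    φ (massSource v b r Λ B ζ κ)
      = massSource v (φ b) (φ r) (φ Λ) (φ B) (fun i => φ (ζ i)) (fun i => φ (κ i)) := by
  simp only [massSource, map_smul, map_pow, map_sub, map_add, map_mul, map_one,
    map_kinetic, map_velocity, map_pressure]

section Ideal

variable {I : Ideal 𝔸} {b r Λ B : 𝔸} {ζ κ h ξ : Fin (N - 1) → 𝔸}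

theorem real_smul_mem (I : Ideal 𝔸) (c : ℝ) {x : 𝔸} (hx : x ∈ I) : c • x ∈ I := by
  rw [Algebra.smul_def]
  exact I.mul_mem_left _ hx

theorem modeSum_mem (hζ : ∀ i, ζ i ∈ I) (j : ℕ) : modeSum v r ζ j ∈ I :=
  I.sum_mem fun i _ => real_smul_mem I _ (I.mul_mem_left _ (hζ i))

theorem modeMul_mem (hζ : ∀ i, ζ i ∈ I) (hξ : ∀ i, ξ i ∈ I) (c : Fin (N - 1)) :
    modeMul C r ζ ξ c ∈ I ^ 2 :=
  Ideal.sum_mem _ fun a _ => Ideal.sum_mem _ fun b _ =>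
    real_smul_mem _ _ (Ideal.mul_mem_left _ _ (mul_mem_sq (hζ a) (hξ b)))

theorem velocity_mem (hζ : ∀ i, ζ i ∈ I) (hκ : ∀ i, κ i ∈ I) (i : Fin (N - 1)) :
    velocity r ζ κ i ∈ I :=
  I.add_mem (real_smul_mem I _ (hζ i)) (I.mul_mem_left _ (hκ i))

theorem acceleration_mem (hζ : ∀ i, ζ i ∈ I) (hh : ∀ i, h i ∈ I) (i : Fin (N - 1)) :
    acceleration r ζ h i ∈ I :=
  I.add_mem (real_smul_mem I _ (hζ i)) (I.mul_mem_left _ (hh i))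

theorem kinetic_mem (hζ : ∀ i, ζ i ∈ I) : kinetic v r ζ ∈ I ^ 2 :=
  Ideal.sum_mem _ fun j _ => real_smul_mem _ _ (Ideal.pow_mem_pow (modeSum_mem v hζ j) 2)

theorem sqDefect_mem (hζ : ∀ i, ζ i ∈ I) (j : ℕ) : sqDefect v b r ζ j ∈ I :=
  real_smul_mem _ _ (I.add_mem (real_smul_mem _ _ (modeSum_mem v hζ j))
    (I.mul_mem_left _ (I.pow_mem_of_mem (modeSum_mem v hζ j) 2 two_pos)))

theorem pressure_mem (hζ : ∀ i, ζ i ∈ I) : pressure v b r ζ ∈ I ^ 2 :=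
  real_smul_mem _ _ (Ideal.sum_mem _ fun j _ =>
    Ideal.pow_mem_pow (I.sub_mem (sqDefect_mem v hζ j) (sqDefect_mem v hζ (j - 1))) 2)

theorem forcing_mem (hΛ : Λ ∈ I) (hB : B ∈ I) (hζ : ∀ i, ζ i ∈ I) (hκ : ∀ i, κ i ∈ I)
    (hh : ∀ i, h i ∈ I) (i : Fin (N - 1)) : forcing v C b r Λ B ζ κ h i ∈ I ^ 2 := by
  refine Ideal.add_mem _ (Ideal.sub_mem _ (mul_mem_sq ?_
    (acceleration_mem hζ hh i)) (mul_mem_sq ?_ (velocity_mem hζ hκ i)))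
    (Ideal.mul_mem_left _ _ (Ideal.add_mem _ (real_smul_mem _ _
    (modeMul_mem C hζ hζ i)) (modeMul_mem C hζ (fun k => ?_) i)))
  · exact I.add_mem (real_smul_mem _ _ hB) (real_smul_mem _ _ hΛ)
  · exact I.sub_mem (I.sub_mem (real_smul_mem _ _ hB)
      (real_smul_mem _ _ (sq_le_self I (pressure_mem v hζ)))) (real_smul_mem _ _ hΛ)
  · exact real_smul_mem _ _ (I.add_mem (hζ k) (real_smul_mem _ _
      (I.mul_mem_left _ (sq_le_self I (modeMul_mem C hζ hζ k)))))

theorem massSource_mem (hζ : ∀ i, ζ i ∈ I) (hκ : ∀ i, κ i ∈ I) :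
    massSource v b r Λ B ζ κ ∈ I ^ 2 :=
  Ideal.add_mem _ (Ideal.mul_mem_left _ _ (kinetic_mem v (velocity_mem hζ hκ)))
    (pressure_mem v hζ)

end Ideal

section Algebra

variable {v C}

theorem modeSum_add (r : 𝔸) (ζ ξ : Fin (N - 1) → 𝔸) (j : ℕ) :
    modeSum v r (fun i => ζ i + ξ i) j = modeSum v r ζ j + modeSum v r ξ j := by
  simp only [modeSum, mul_add, smul_add, Finset.sum_add_distrib]

theorem modeSum_mul (r a : 𝔸) (ζ : Fin (N - 1) → 𝔸) (j : ℕ) :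
    modeSum v r (fun i => a * ζ i) j = a * modeSum v r ζ j := by
  simp only [modeSum, Finset.mul_sum, mul_smul_comm, mul_left_comm]

theorem modeSum_mul_modeSum
    (hC0 : ∀ a b c : Fin (N - 1), (a : ℕ) + b < c → C a b c = 0)
    (hC : ∀ a b j, v a j * v b j = ∑ c, C a b c * v c j)
    (r : 𝔸) (ζ ξ : Fin (N - 1) → 𝔸) (j : ℕ) :
    modeSum v r ζ j * modeSum v r ξ j = modeSum v r (modeMul C r ζ ξ) j := by
  simp only [modeSum, modeMul]
  rw [Finset.sum_mul_sum]
  simp only [Finset.mul_sum, Finset.smul_sum]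
  conv_rhs => rw [Finset.sum_comm]
  refine Finset.sum_congr rfl fun a _ => ?_
  conv_rhs => rw [Finset.sum_comm]
  refine Finset.sum_congr rfl fun b _ => ?_
  rw [smul_mul_smul_comm, vExt_mul hC, Finset.sum_smul]
  refine Finset.sum_congr rfl fun c _ => ?_
  rcases lt_or_ge ((a : ℕ) + b) c with h | h
  · simp [hC0 a b c h]
  · have : r ^ (a : ℕ) * ζ a * (r ^ (b : ℕ) * ξ b)
        = r ^ (c : ℕ) * (r ^ ((a : ℕ) + b - c) * (ζ a * ξ b)) := by
      rw [← mul_assoc (r ^ (c : ℕ)), ← pow_add, Nat.add_sub_cancel' h, pow_add]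
      ring
    rw [this, mul_smul_comm, smul_smul, mul_comm]

theorem modeSum_eigen (hv : IsEigenBasis N v) (r : ℝ) (ζ : Fin (N - 1) → ℝ) {J : ℕ}
    (hJ : J ∈ Finset.Icc 1 (N - 1)) :
    2 * weight N J * modeSum v r ζ J - weight N (J - 1 : ℕ) * modeSum v r ζ (J - 1)
      - weight N (J + 1 : ℕ) * modeSum v r ζ (J + 1)
      = modeSum v r (fun i => eigval i * ζ i) J := by
  simp only [modeSum, Finset.mul_sum, ← Finset.sum_sub_distrib, smul_eq_mul]
  refine Finset.sum_congr rfl fun i _ => ?_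
  linear_combination r ^ (i : ℕ) * ζ i * vExt_eigen hv i hJ

end Algebra

end Modes

section FieldEquations

variable {N : ℕ} {v : Fin (N - 1) → Fin (N - 1) → ℝ}

/-- The gauge fields with mode coefficients `ζ`. -/
def gaugeField (v : Fin (N - 1) → Fin (N - 1) → ℝ) (ζ : Fin (N - 1) → ℝ → ℝ) (j : ℕ) (r : ℝ) : ℝ :=
  √(weight N j) * (1 + r ^ 2 * modeSum v r (fun i => ζ i r) j)

theorem weight_nonneg {j : ℕ} (hj : j ≤ N) : 0 ≤ weight N j := by
  have : (j : ℝ) ≤ N := by exact_mod_cast hj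
  exact mul_nonneg j.cast_nonneg (sub_nonneg.2 this)

theorem hasDerivAt_sq_mul_modeSum {ζ : Fin (N - 1) → ℝ → ℝ} {κ : Fin (N - 1) → ℝ} {r : ℝ}
    (hζ : ∀ i, HasDerivAt (ζ i) (r * κ i) r) (j : ℕ) :
    HasDerivAt (fun s => s ^ 2 * modeSum v s (fun i => ζ i s) j)
      (r * modeSum v r (velocity r (fun i => ζ i r) κ) j) r := by
  have h : ∀ i ∈ Finset.univ, HasDerivAt
      (fun s => s ^ 2 * vExt v i j • (s ^ (i : ℕ) * ζ i s))
      (r * vExt v i j • (r ^ (i : ℕ) * velocity r (fun i => ζ i r) κ i)) r := by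
    intro i _
    have h1 := ((hasDerivAt_pow ((i : ℕ) + 2) r).mul (hζ i)).const_mul (vExt v i j)
    refine (h1.congr_deriv ?_).congr_of_eventuallyEq (Eventually.of_forall fun s => ?_)
    · simp only [velocity, smul_eq_mul, Nat.add_succ_sub_one]
      push_cast
      ring
    · simp only [smul_eq_mul, Pi.mul_apply]
      ring
  simpa only [modeSum, Finset.mul_sum] using HasDerivAt.fun_sum h

theorem hasDerivAt_mul_modeSum_velocity {ζ κ : Fin (N - 1) → ℝ → ℝ} {h : Fin (N - 1) → ℝ} {r : ℝ}
    (hr : r ≠ 0) (hζ : ∀ i, HasDerivAt (ζ i) (r * κ i r) r)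
    (hκ : ∀ i, HasDerivAt (κ i) ((h i - (2 * (i : ℕ) + 5) * κ i r) / r) r) (j : ℕ) :
    HasDerivAt (fun s => s * modeSum v s (velocity s (fun i => ζ i s) (fun i => κ i s)) j)
      (modeSum v r (acceleration r (fun i => ζ i r) h) j) r := by
  have h : ∀ i ∈ Finset.univ, HasDerivAt
      (fun s => s * vExt v i j •
        (s ^ (i : ℕ) * velocity s (fun i => ζ i s) (fun i => κ i s) i))
      (vExt v i j • (r ^ (i : ℕ) * acceleration r (fun i => ζ i r) h i)) r := by
    intro i _
    have h1 := (((hasDerivAt_pow ((i : ℕ) + 1) r).mul (hζ i)).const_mul ((i : ℕ) + 2 : ℝ)).add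
      ((hasDerivAt_pow ((i : ℕ) + 3) r).mul (hκ i))
    refine ((h1.const_mul (vExt v i j)).congr_deriv ?_).congr_of_eventuallyEq
      (Eventually.of_forall fun s => ?_)
    · simp only [acceleration, eigval, smul_eq_mul, Nat.add_succ_sub_one]
      push_cast
      field_simp
      ring
    · simp only [velocity, smul_eq_mul, Pi.mul_apply, Pi.add_apply]
      ring
  simpa only [modeSum, Finset.mul_sum] using HasDerivAt.fun_sum h

theorem gaugeField_sq (ζ : Fin (N - 1) → ℝ → ℝ) {j : ℕ} (hj : j ≤ N) (r : ℝ) :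
    gaugeField v ζ j r ^ 2 = weight N j + r ^ 2 * sqDefect v 1 r (fun i => ζ i r) j := by
  rw [gaugeField, mul_pow, Real.sq_sqrt (weight_nonneg hj), sqDefect]
  simp only [smul_eq_mul]
  ring

theorem pTheta_gaugeField (ζ : Fin (N - 1) → ℝ → ℝ) {r : ℝ} (hr : r ≠ 0) :
    pTheta N (gaugeField v ζ) r = pressure v 1 r (fun i => ζ i r) := by
  have h : ∀ j ∈ Finset.Icc 1 N, (gaugeField v ζ j r ^ 2 - gaugeField v ζ (j - 1) r ^ 2
      - (N : ℝ) - 1 + 2 * (j : ℝ)) ^ 2 = r ^ 4 * (sqDefect v 1 r (fun i => ζ i r) j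
        - sqDefect v 1 r (fun i => ζ i r) (j - 1)) ^ 2 := by
    intro j hj
    rw [Finset.mem_Icc] at hj
    rw [gaugeField_sq ζ hj.2, gaugeField_sq ζ (by omega)]
    have : weight N j - weight N (j - 1 : ℕ) = N + 1 - 2 * j := by
      rw [Nat.cast_sub hj.1]
      simp only [weight]
      push_cast
      ring
    rw [show weight N j + r ^ 2 * sqDefect v 1 r (fun i => ζ i r) j
      - (weight N (j - 1 : ℕ) + r ^ 2 * sqDefect v 1 r (fun i => ζ i r) (j - 1)) - (N : ℝ) - 1
      + 2 * (j : ℝ) = r ^ 2 * (sqDefect v 1 r (fun i => ζ i r) j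
        - sqDefect v 1 r (fun i => ζ i r) (j - 1)) by linear_combination this]
    ring
  rw [pTheta, pThetaVal, Finset.sum_congr rfl h, ← Finset.mul_sum, pressure, smul_eq_mul]
  field_simp

variable {C : Fin (N - 1) → Fin (N - 1) → Fin (N - 1) → ℝ}

theorem sqDefect_eq (hC0 : ∀ a b c : Fin (N - 1), (a : ℕ) + b < c → C a b c = 0)
    (hC : ∀ a b j, v a j * v b j = ∑ c, C a b c * v c j)
    (r : ℝ) (ζ : Fin (N - 1) → ℝ) (j : ℕ) :
    sqDefect v 1 r ζ j = 2 * weight N j * modeSum v r (halfDefect C 1 r ζ) j := by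
  have : modeSum v r (halfDefect C 1 r ζ) j
      = modeSum v r ζ j + 1 / 2 * (r ^ 2 * modeSum v r ζ j ^ 2) := by
    rw [show halfDefect C 1 r ζ = fun i => ζ i + 1 / 2 * (r ^ 2 * modeMul C r ζ ζ i) by
        funext i
        simp [halfDefect],
      modeSum_add, modeSum_mul, modeSum_mul, pow_two (modeSum v r ζ j),
      modeSum_mul_modeSum hC0 hC]
  rw [this]
  simp only [sqDefect, smul_eq_mul]
  ring

theorem WF_gaugeField (hv : IsEigenBasis N v)
    (hC0 : ∀ a b c : Fin (N - 1), (a : ℕ) + b < c → C a b c = 0)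
    (hC : ∀ a b j, v a j * v b j = ∑ c, C a b c * v c j)
    (ζ : Fin (N - 1) → ℝ → ℝ) (r : ℝ) {j : ℕ} (hj : j ∈ Finset.Icc 1 (N - 1)) :
    WF (gaugeField v ζ) j r
      = -(r ^ 2 * modeSum v r (fun k => eigval k * halfDefect C 1 r (fun i => ζ i r) k) j) := by
  rw [← modeSum_eigen hv r _ hj]
  rw [Finset.mem_Icc] at hj
  rw [WF, WVal, gaugeField_sq ζ (by omega), gaugeField_sq ζ (by omega),
    gaugeField_sq ζ (by omega), sqDefect_eq hC0 hC, sqDefect_eq hC0 hC, sqDefect_eq hC0 hC]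
  have : 1 - weight N j + 1 / 2 * (weight N (j - 1 : ℕ) + weight N (j + 1 : ℕ)) = 0 := by
    rw [Nat.cast_sub hj.1]
    simp only [weight]
    push_cast
    ring
  linear_combination this

theorem modeSum_forcing (hC0 : ∀ a b c : Fin (N - 1), (a : ℕ) + b < c → C a b c = 0)
    (hC : ∀ a b j, v a j * v b j = ∑ c, C a b c * v c j)
    (r Λ B : ℝ) (ζ κ h : Fin (N - 1) → ℝ) (j : ℕ) :
    modeSum v r (forcing v C 1 r Λ B ζ κ h) j
      = (2 * B + 1 / 3 * Λ) * modeSum v r (acceleration r ζ h) j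
        - (2 * B - 2 * pressure v 1 r ζ - 2 / 3 * Λ) * modeSum v r (velocity r ζ κ) j
        + 1 / 2 * modeSum v r (fun i => eigval i * modeMul C r ζ ζ i) j
        + modeSum v r ζ j * modeSum v r (fun k => eigval k * halfDefect C 1 r ζ k) j := by
  rw [modeSum_mul_modeSum hC0 hC, sub_eq_add_neg, ← neg_mul, ← modeSum_mul, ← modeSum_mul,
    ← modeSum_mul, ← modeSum_add, ← modeSum_add, ← modeSum_add]
  congr 1
  funext i
  simp only [forcing, smul_eq_mul]
  ring

/-- The Fuchsian system for the mode coefficients, at the radius `r`. -/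
def ModeSystem (v : Fin (N - 1) → Fin (N - 1) → ℝ)
    (C : Fin (N - 1) → Fin (N - 1) → Fin (N - 1) → ℝ) (b Λ : ℝ)
    (ζ κ h : Fin (N - 1) → ℝ → ℝ) (B τ : ℝ → ℝ) (r : ℝ) : Prop :=
  (∀ i, HasDerivAt (ζ i) (r * κ i r) r) ∧
  (∀ i, HasDerivAt (κ i) ((h i r - (2 * (i : ℕ) + 5) * κ i r) / r) r) ∧
  HasDerivAt B ((massSource v b r Λ (B r) (fun i => ζ i r) (fun i => κ i r) - 3 * B r) / r) r ∧
  HasDerivAt τ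
    ((kinetic v r (velocity r (fun i => ζ i r) (fun i => κ i r)) - 2 * τ r) / r) r ∧
  ∀ i, h i r = forcing v C b r Λ (B r) (fun i => ζ i r) (fun i => κ i r) (fun i => h i r) i

/-- Solutions of the Fuchsian system for the mode coefficients solve the field equations. -/
theorem eym_of_modes (hv : IsEigenBasis N v)
    (hC0 : ∀ a b c : Fin (N - 1), (a : ℕ) + b < c → C a b c = 0)
    (hC : ∀ a b j, v a j * v b j = ∑ c, C a b c * v c j) {Λ δ : ℝ} (S₀ : ℝ)
    {ζ κ h : Fin (N - 1) → ℝ → ℝ} {B τ : ℝ → ℝ}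
    (hsys : ∀ r ∈ Set.Ioo 0 δ, ModeSystem v C 1 Λ ζ κ h B τ r) {r : ℝ} (hr : r ∈ Set.Ioo 0 δ) :
    EYM N Λ (fun s => s ^ 3 * B s) (fun s => S₀ * Real.exp (2 * s ^ 2 * τ s))
      (gaugeField v ζ) r := by
  obtain ⟨hζ, hκ, hB, hτ, hh⟩ := hsys r hr
  have hr0 : r ≠ 0 := hr.1.ne'
  have hd : ∀ j, ∀ s ∈ Set.Ioo 0 δ, HasDerivAt (gaugeField v ζ j) (√(weight N j) *
      (s * modeSum v s (velocity s (fun i => ζ i s) (fun i => κ i s)) j)) s := fun j s hs =>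
    ((hasDerivAt_sq_mul_modeSum (hsys s hs).1 j).const_add 1).const_mul _
  have hd2 : ∀ j, HasDerivAt (deriv (gaugeField v ζ j)) (√(weight N j) *
      modeSum v r (acceleration r (fun i => ζ i r) (fun i => h i r)) j) r := fun j => by
    refine ((hasDerivAt_mul_modeSum_velocity hr0 hζ hκ j).const_mul
      _).congr_of_eventuallyEq ?_
    filter_upwards [isOpen_Ioo.mem_nhds hr] with s hs using (hd j s hs).deriv
  have hG : GF N (gaugeField v ζ) r
      = r ^ 2 * kinetic v r (velocity r (fun i => ζ i r) (fun i => κ i r)) := by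
    rw [GF, kinetic, Finset.mul_sum]
    refine Finset.sum_congr rfl fun j hj => ?_
    rw [(hd j r hr).deriv, mul_pow, Real.sq_sqrt (weight_nonneg (by
      rw [Finset.mem_Icc] at hj; omega)), smul_eq_mul]
    ring
  have hμ : muF Λ (fun s => s ^ 3 * B s) r = 1 - r ^ 2 * (2 * B r + 1 / 3 * Λ) := by
    rw [muF]
    field_simp
    ring
  refine ⟨by simp [gaugeField, weight], by simp [gaugeField, weight], ?_, ?_, fun j hj =>
    ⟨(hd j r hr).differentiableAt, (hd2 j).differentiableAt, ?_⟩⟩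
  · refine ((hasDerivAt_pow 3 r).mul hB).congr_deriv ?_
    rw [hμ, hG, pTheta_gaugeField ζ hr0]
    simp only [massSource, smul_eq_mul]
    field_simp
    push_cast
    ring
  · refine (((((hasDerivAt_pow 2 r).const_mul 2).mul hτ).exp).const_mul S₀).congr_deriv ?_
    rw [hG]
    simp only [Pi.mul_apply]
    field_simp
    push_cast
    ring
  · rw [(hd2 j).deriv, (hd j r hr).deriv, hμ, pTheta_gaugeField ζ hr0, WF_gaugeField hv hC0 hC ζ r hj]
    have hH : modeSum v r (fun i => h i r) j = modeSum v r (forcing v C 1 r Λ (B r) (fun i => ζ i r)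
      (fun i => κ i r) (fun i => h i r)) j := congrArg (modeSum v r · j) (funext hh)
    rw [modeSum_forcing hC0 hC] at hH
    have hacc : modeSum v r (acceleration r (fun i => ζ i r) (fun i => h i r)) j
        = modeSum v r (fun i => eigval i * ζ i r) j + r ^ 2 * modeSum v r (fun i => h i r) j := by
      rw [← modeSum_mul, ← modeSum_add]
      rfl
    have hhalf : modeSum v r (fun k => eigval k * halfDefect C 1 r (fun i => ζ i r) k) j
        = modeSum v r (fun i => eigval i * ζ i r) j + r ^ 2 * (1 / 2 *
          modeSum v r (fun i => eigval i * modeMul C r (fun i => ζ i r) (fun i => ζ i r) i) j) := by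
      rw [← modeSum_mul, ← modeSum_mul, ← modeSum_add]
      congr 1
      funext i
      simp only [halfDefect, smul_eq_mul]
      ring
    simp only [gaugeField]
    linear_combination √(weight N j) * (r ^ 2 * hacc - r ^ 2 * hhalf + r ^ 4 * hH)

section Scaling

variable (r c : ℝ) (ζ ξ κ h : Fin (N - 1) → ℝ)

theorem modeSum_scale (j : ℕ) :
    modeSum v r (fun i => c ^ ((i : ℕ) + 1) * ζ i) j = c * modeSum v (c * r) ζ j := by
  simp only [modeSum, smul_eq_mul, Finset.mul_sum]
  exact Finset.sum_congr rfl fun i _ => by ring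

theorem velocity_scale : velocity r (fun i => c ^ ((i : ℕ) + 1) * ζ i)
    (fun i => c ^ ((i : ℕ) + 3) * κ i) = fun i : Fin (N - 1) => c ^ ((i : ℕ) + 1) * velocity (c * r) ζ κ i := by
  funext i
  simp only [velocity, smul_eq_mul]
  ring

theorem acceleration_scale : acceleration r (fun i => c ^ ((i : ℕ) + 1) * ζ i)
    (fun i => c ^ ((i : ℕ) + 3) * h i)
      = fun i : Fin (N - 1) => c ^ ((i : ℕ) + 1) * acceleration (c * r) ζ h i := by
  funext i
  simp only [acceleration, smul_eq_mul]
  ring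

theorem kinetic_scale :
    kinetic v r (fun i => c ^ ((i : ℕ) + 1) * ζ i) = c ^ 2 * kinetic v (c * r) ζ := by
  simp only [kinetic, modeSum_scale, smul_eq_mul, Finset.mul_sum]
  exact Finset.sum_congr rfl fun i _ => by ring

theorem modeMul_scale (hC0 : ∀ a b c : Fin (N - 1), (a : ℕ) + b < c → C a b c = 0)
    (k : Fin (N - 1)) :
    modeMul C r (fun i => c ^ ((i : ℕ) + 1) * ζ i) (fun i => c ^ ((i : ℕ) + 1) * ξ i) k
      = c ^ ((k : ℕ) + 2) * modeMul C (c * r) ζ ξ k := by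
  simp only [modeMul, Finset.mul_sum]
  refine Finset.sum_congr rfl fun a _ => Finset.sum_congr rfl fun b _ => ?_
  rcases lt_or_ge ((a : ℕ) + b) k with h | h
  · simp [hC0 a b k h]
  · obtain ⟨d, hd⟩ := Nat.exists_eq_add_of_le h
    have h1 : c ^ ((a : ℕ) + 1) * c ^ ((b : ℕ) + 1) = c ^ ((k : ℕ) + 2) * c ^ d := by
      rw [← pow_add, ← pow_add]
      congr 1
      omega
    rw [hd, Nat.add_sub_cancel_left, mul_pow]
    simp only [smul_eq_mul]
    linear_combination C a b k * r ^ d * ζ a * ξ b * h1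

variable {b c}

theorem sqDefect_scale (hbc : b * c = 1) (j : ℕ) : sqDefect v 1 r (fun i => c ^ ((i : ℕ) + 1) * ζ i) j
    = c * sqDefect v b (c * r) ζ j := by
  simp only [sqDefect, modeSum_scale, smul_eq_mul]
  linear_combination -(weight N j * r ^ 2 * c ^ 2 * modeSum v (c * r) ζ j ^ 2) * hbc

theorem pressure_scale (hbc : b * c = 1) : pressure v 1 r (fun i => c ^ ((i : ℕ) + 1) * ζ i)
    = c ^ 2 * pressure v b (c * r) ζ := by
  simp only [pressure, sqDefect_scale r ζ hbc, smul_eq_mul, Finset.mul_sum]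
  exact Finset.sum_congr rfl fun i _ => by ring

theorem halfDefect_scale (hbc : b * c = 1)
    (hC0 : ∀ a b c : Fin (N - 1), (a : ℕ) + b < c → C a b c = 0)
    (k : Fin (N - 1)) : halfDefect C 1 r (fun i => c ^ ((i : ℕ) + 1) * ζ i) k
      = c ^ ((k : ℕ) + 1) * halfDefect C b (c * r) ζ k := by
  simp only [halfDefect, modeMul_scale r c ζ ζ hC0, smul_eq_mul]
  linear_combination -(1 / 2 * r ^ 2 * c ^ ((k : ℕ) + 2) * modeMul C (c * r) ζ ζ k) * hbc

theorem forcing_scale (hbc : b * c = 1)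
    (hC0 : ∀ a b c : Fin (N - 1), (a : ℕ) + b < c → C a b c = 0)
    (Λ B : ℝ) (k : Fin (N - 1)) :
    forcing v C 1 r (c ^ 2 * Λ) (c ^ 2 * B) (fun i => c ^ ((i : ℕ) + 1) * ζ i)
        (fun i => c ^ ((i : ℕ) + 3) * κ i) (fun i => c ^ ((i : ℕ) + 3) * h i) k
      = c ^ ((k : ℕ) + 3) * forcing v C b (c * r) Λ B ζ κ h k := by
  simp only [forcing, acceleration_scale, velocity_scale, pressure_scale r ζ hbc,
    modeMul_scale r c ζ ζ hC0, halfDefect_scale r ζ hbc hC0, smul_eq_mul,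
    mul_left_comm (eigval _) (c ^ _), modeMul_scale r c ζ _ hC0]
  linear_combination -(c ^ ((k : ℕ) + 2) * (eigval k / 2 * modeMul C (c * r) ζ ζ k
    + modeMul C (c * r) ζ (fun k => eigval k * halfDefect C b (c * r) ζ k) k)) * hbc

theorem massSource_scale (hbc : b * c = 1) (Λ B : ℝ) :
    massSource v 1 r (c ^ 2 * Λ) (c ^ 2 * B) (fun i => c ^ ((i : ℕ) + 1) * ζ i)
        (fun i => c ^ ((i : ℕ) + 3) * κ i)
      = c ^ 2 * massSource v b (c * r) Λ B ζ κ := by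
  simp only [massSource, velocity_scale, kinetic_scale, pressure_scale r ζ hbc, smul_eq_mul]
  ring

/-- Rescaling the radius turns the self-interaction strength `b` into `1`. -/
theorem ModeSystem.scale (hC0 : ∀ a b c : Fin (N - 1), (a : ℕ) + b < c → C a b c = 0)
    {b c : ℝ} (hbc : b * c = 1) {Λ : ℝ} {ζ κ h : Fin (N - 1) → ℝ → ℝ} {B τ : ℝ → ℝ} {r : ℝ}
    (hsys : ModeSystem v C b Λ ζ κ h B τ (c * r)) :
    ModeSystem v C 1 (c ^ 2 * Λ) (fun i s => c ^ ((i : ℕ) + 1) * ζ i (c * s))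
      (fun i s => c ^ ((i : ℕ) + 3) * κ i (c * s)) (fun i s => c ^ ((i : ℕ) + 3) * h i (c * s))
      (fun s => c ^ 2 * B (c * s)) (fun s => c ^ 2 * τ (c * s)) r := by
  obtain ⟨hζ, hκ, hB, hτ, hh⟩ := hsys
  have hc : c ≠ 0 := right_ne_zero_of_mul_eq_one hbc
  have hcomp : ∀ {f : ℝ → ℝ} {f' : ℝ} (d : ℝ), HasDerivAt f f' (c * r) →
      HasDerivAt (fun s => d * f (c * s)) (d * (f' * c)) r := fun d hf => by
    have := (hf.comp r ((hasDerivAt_id r).const_mul c)).const_mul d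
    simpa using this
  have hdiv : ∀ x, x / (c * r) * c = x / r := fun x => by
    rw [div_mul_eq_mul_div, mul_comm c r, mul_div_mul_right _ _ hc]
  refine ⟨fun i => ?_, fun i => ?_, ?_, ?_, fun i => ?_⟩
  · refine (hcomp _ (hζ i)).congr_deriv ?_
    ring
  · refine (hcomp _ (hκ i)).congr_deriv ?_
    rw [hdiv]
    ring
  · refine (hcomp _ hB).congr_deriv ?_
    rw [massSource_scale r _ _ hbc, hdiv]
    ring
  · refine (hcomp _ hτ).congr_deriv ?_
    rw [velocity_scale, kinetic_scale, hdiv]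
    ring
  · rw [forcing_scale r _ _ _ hbc hC0, ← hh i]

end Scaling

end FieldEquations

theorem hasDerivAt_of_eq_radialMean {n : ℕ} {f Y : C(unitInterval, ℝ)} (hY : Y = radialMean n f)
    {y : ℝ → ℝ} {r R : ℝ} (hr : 0 < r) (hrR : r < R) (hy : ∀ s : unitInterval, Y s = y (R * s)) :
    HasDerivAt y ((f ⟨r / R, div_nonneg hr.le (hr.trans hrR).le, (div_le_one (hr.trans hrR)).2 hrR.le⟩
      - (n + 1) * y r) / r) r := by
  have hR : 0 < R := hr.trans hrR
  have hmem : r / R ∈ Set.Ioo (0 : ℝ) 1 := ⟨by positivity, (div_lt_one hR).2 hrR⟩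
  have hval : ∀ t, t / R ∈ Set.Icc (0 : ℝ) 1 → Set.IccExtend zero_le_one Y (t / R) = y t := by
    intro t ht
    rw [Set.IccExtend_of_mem _ _ ht, hy]
    simp only
    rw [mul_div_cancel₀ t hR.ne']
  have h := (hasDerivAt_radialMean n f hmem).comp r ((hasDerivAt_id r).div_const R)
  rw [← hY, Set.IccExtend_of_mem _ _ (Set.Ioo_subset_Icc_self hmem),
    hval r (Set.Ioo_subset_Icc_self hmem)] at h
  refine (h.congr_deriv ?_).congr_of_eventuallyEq ?_
  · field_simp
  · have hc : ContinuousAt (fun t : ℝ => t / R) r := by fun_prop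
    filter_upwards [hc.preimage_mem_nhds (isOpen_Ioo.mem_nhds hmem)] with t ht
    exact (hval t (Set.Ioo_subset_Icc_self ht)).symm

section SmallData

variable {N : ℕ}

/-- The unknowns of the Fuchsian system: second derivatives, first derivatives and increments of
the mode coefficients, then the rescaled mass (`true`) and the rescaled logarithm of `S`
(`false`). -/
abbrev Unknown (N : ℕ) : Type := Fin (N - 1) ⊕ (Fin (N - 1) ⊕ (Fin (N - 1) ⊕ Bool))

/-- The polynomial ring in which the right-hand sides of the Fuchsian system live. -/
abbrev JetPoly (N : ℕ) : Type :=
  MvPolynomial (Option (Option (Option (Fin (N - 1)))) ⊕ Unknown N) ℝ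

/-- The polynomial variable for the radius. -/
def radiusVar : JetPoly N := .X (.inl none)

/-- The polynomial variable for the strength of the self-interaction. -/
def couplingVar : JetPoly N := .X (.inl (some none))

/-- The polynomial variable for the cosmological constant. -/
def cosmoVar : JetPoly N := .X (.inl (some (some none)))

/-- The polynomial variable for the rescaled mass. -/
def massVar : JetPoly N := .X (.inr (.inr (.inr (.inr true))))

/-- The polynomials for the mode coefficients. -/
def modeVar (i : Fin (N - 1)) : JetPoly N :=
  .X (.inl (some (some (some i)))) + radiusVar ^ 2 * .X (.inr (.inr (.inr (.inl i))))

/-- The polynomial variables for the first derivatives of the mode coefficients. -/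
def velVar (i : Fin (N - 1)) : JetPoly N := .X (.inr (.inr (.inl i)))

/-- The polynomial variables for the second derivatives of the mode coefficients. -/
def accVar (i : Fin (N - 1)) : JetPoly N := .X (.inr (.inl i))

variable (v : Fin (N - 1) → Fin (N - 1) → ℝ) (C : Fin (N - 1) → Fin (N - 1) → Fin (N - 1) → ℝ)

/-- The forcing terms as polynomials. -/
def forcingPoly (i : Fin (N - 1)) : JetPoly N :=
  forcing v C couplingVar radiusVar cosmoVar massVar modeVar velVar accVar i

/-- The right-hand sides of the Fuchsian system. -/
def fuchsianRHS : Unknown N → JetPoly N :=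
  Sum.elim (forcingPoly v C) (Sum.elim (forcingPoly v C) (Sum.elim (forcingPoly v C) fun b =>
    bif b then massSource v couplingVar radiusVar cosmoVar massVar modeVar velVar
    else kinetic v radiusVar (velocity radiusVar modeVar velVar)))

/-- The integral operators inverting the singular parts of the Fuchsian system. -/
def fuchsianOp : Unknown N → C(unitInterval, ℝ) →L[ℝ] C(unitInterval, ℝ) :=
  Sum.elim (fun _ => .id ℝ _) (Sum.elim (fun i => radialMean (2 * i + 4))
    (Sum.elim (fun i => (radialMean 1).comp (radialMean (2 * i + 4))) fun b =>
      bif b then radialMean 2 else radialMean 1))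

theorem fuchsianRHS_mem (l : Unknown N) : fuchsianRHS v C l ∈ RingHom.ker
    (MvPolynomial.constantCoeff (σ := Option (Option (Option (Fin (N - 1)))) ⊕ Unknown N) (R := ℝ)) ^ 2 := by
  have hX : ∀ x, (MvPolynomial.X x : JetPoly N) ∈ RingHom.ker (MvPolynomial.constantCoeff
      (σ := Option (Option (Option (Fin (N - 1)))) ⊕ Unknown N) (R := ℝ)) := fun x => by
    simp [RingHom.mem_ker]
  have hmode : ∀ i, (modeVar i : JetPoly N) ∈ RingHom.ker (MvPolynomial.constantCoeff
      (σ := Option (Option (Option (Fin (N - 1)))) ⊕ Unknown N) (R := ℝ)) := fun i =>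
    Ideal.add_mem _ (hX _) (Ideal.mul_mem_left _ _ (hX _))
  have hF : ∀ i, forcingPoly v C i ∈ RingHom.ker (MvPolynomial.constantCoeff
      (σ := Option (Option (Option (Fin (N - 1)))) ⊕ Unknown N) (R := ℝ)) ^ 2 := fun i =>
    forcing_mem v C (hX _) (hX _) hmode (fun _ => hX _) (fun _ => hX _) i
  rcases l with i | i | i | b
  · exact hF i
  · exact hF i
  · exact hF i
  · cases b
    · exact kinetic_mem v (velocity_mem hmode fun _ => hX _)
    · exact massSource_mem v hmode fun _ => hX _

theorem fuchsianOp_dilate (l : Unknown N) (s : unitInterval) (f : C(unitInterval, ℝ)) :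
    fuchsianOp l (dilate s f) = dilate s (fuchsianOp l f) := by
  rcases l with i | i | i | b
  · rfl
  · exact radialMean_dilate _ s f
  · simp [fuchsianOp, radialMean_dilate]
  · cases b <;> exact radialMean_dilate _ s f

/-- Existence of solutions for small parameters, with analytic dependence. The parameters are
`b` (`none`), `Λ` (`some none`) and the initial values of the mode coefficients. -/
theorem exists_small_solution :
    ∃ δ > 0, ∃ (χ : (Option (Option (Fin (N - 1))) → ℝ) × ℝ → Fin (N - 1) → ℝ)
      (B τ : (Option (Option (Fin (N - 1))) → ℝ) × ℝ → ℝ),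
      (∀ q, ‖q‖ < δ → (∀ i, AnalyticAt ℝ (fun q => χ q i) q) ∧ AnalyticAt ℝ B q ∧
        AnalyticAt ℝ τ q) ∧
      ∀ p : Option (Option (Fin (N - 1))) → ℝ, ‖p‖ < δ → ∃ κ h : Fin (N - 1) → ℝ → ℝ,
        ∀ r ∈ Set.Ioo 0 δ, ModeSystem v C (p none) (p (some none))
          (fun i s => p (some (some i)) + s ^ 2 * χ (p, s) i) κ h
          (fun s => B (p, s)) (fun s => τ (p, s)) r := by
  obtain ⟨δ, hδ, y, hyan, hy⟩ := exists_analytic_dilation_solution (fuchsianRHS v C)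
    (fuchsianRHS_mem v C) fuchsianOp fuchsianOp_dilate
  let h : (Option (Option (Fin (N - 1))) → ℝ) → Fin (N - 1) → ℝ → ℝ := fun p i s => y (p, s) (.inl i)
  let κ : (Option (Option (Fin (N - 1))) → ℝ) → Fin (N - 1) → ℝ → ℝ := fun p i s => y (p, s) (.inr (.inl i))
  let χ : (Option (Option (Fin (N - 1))) → ℝ) × ℝ → Fin (N - 1) → ℝ := fun q i => y q (.inr (.inr (.inl i)))
  let B : (Option (Option (Fin (N - 1))) → ℝ) × ℝ → ℝ := fun q => y q (.inr (.inr (.inr true)))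
  let τ : (Option (Option (Fin (N - 1))) → ℝ) × ℝ → ℝ := fun q => y q (.inr (.inr (.inr false)))
  let ζ : (Option (Option (Fin (N - 1))) → ℝ) → Fin (N - 1) → ℝ → ℝ :=
    fun p i s => p (some (some i)) + s ^ 2 * χ (p, s) i
  refine ⟨δ, hδ, χ, B, τ, fun q hq => ⟨fun i => hyan q hq _, hyan q hq _, hyan q hq _⟩,
    fun p hp => ⟨κ p, h p, fun s hs => ?_⟩⟩
  let e : ℝ → JetPoly N →ₐ[ℝ] ℝ := fun s => MvPolynomial.aeval (jetAt p s (y (p, s)))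
  have hmode : ∀ s i, e s (modeVar i) = ζ p i s := fun s i => by
    simp [e, modeVar, radiusVar, jetAt, ζ, χ]
  have hvel : ∀ s i, e s (velVar i) = κ p i s := fun s i => by simp [e, velVar, jetAt, κ]
  have hacc : ∀ s i, e s (accVar i) = h p i s := fun s i => by simp [e, accVar, jetAt, h]
  have hrad : ∀ s, e s radiusVar = s := fun s => by simp [e, radiusVar, jetAt]
  have hcoup : ∀ s, e s couplingVar = p none := fun s => by simp [e, couplingVar, jetAt]
  have hcos : ∀ s, e s cosmoVar = p (some none) := fun s => by simp [e, cosmoVar, jetAt]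
  have hmass : ∀ s, e s massVar = B (p, s) := fun s => by simp [e, massVar, jetAt, B]
  have hforce : ∀ s i, e s (forcingPoly v C i) = forcing v C (p none) s (p (some none)) (B (p, s))
      (fun i => ζ p i s) (fun i => κ p i s) (fun i => h p i s) i := fun s i => by
    rw [forcingPoly, map_forcing]
    simp only [hmode, hvel, hacc, hrad, hcoup, hcos, hmass]
  have hkin : ∀ s, e s (kinetic v radiusVar (velocity radiusVar modeVar velVar))
      = kinetic v s (velocity s (fun i => ζ p i s) (fun i => κ p i s)) := fun s => by
    rw [map_kinetic]
    simp only [map_velocity, hmode, hvel, hrad]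
  have hms : ∀ s, e s (massSource v couplingVar radiusVar cosmoVar massVar modeVar velVar)
      = massSource v (p none) s (p (some none)) (B (p, s)) (fun i => ζ p i s) (fun i => κ p i s) := fun s => by
    rw [map_massSource]
    simp only [hmode, hvel, hrad, hcoup, hcos, hmass]
  obtain ⟨hκ, hχ, hB, hτ, hh⟩ :
      (∀ i, HasDerivAt (κ p i) ((e s (forcingPoly v C i) - (2 * (i : ℕ) + 5) * κ p i s) / s) s) ∧
      (∀ i, HasDerivAt (fun t => χ (p, t) i) ((κ p i s - 2 * χ (p, s) i) / s) s) ∧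
      HasDerivAt (fun t => B (p, t)) ((e s (massSource v couplingVar radiusVar cosmoVar massVar modeVar velVar)
        - 3 * B (p, s)) / s) s ∧
      HasDerivAt (fun t => τ (p, t)) ((e s (kinetic v radiusVar
        (velocity radiusVar modeVar velVar)) - 2 * τ (p, s)) / s) s ∧
      ∀ i, h p i s = e s (forcingPoly v C i) := by
    obtain ⟨R, hsR, hRδ⟩ := exists_between hs.2
    have hR : 0 < R := hs.1.trans hsR
    obtain ⟨Y, hYfix, hYy⟩ := hy p R hp hR.le hRδ
    let σ : unitInterval := ⟨s / R, div_nonneg hs.1.le hR.le, (div_le_one hR).2 hsR.le⟩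
    have hσ : R * (σ : ℝ) = s := mul_div_cancel₀ s hR.ne'
    have hev : ∀ P : JetPoly N, MvPolynomial.aeval (jet ((p, R), Y)) P σ = e s P := fun P => by
      rw [aeval_jet_apply]
      simp only [hσ, hYy]
      rfl
    refine ⟨fun i => ?_, fun i => ?_, ?_, ?_, fun i => ?_⟩
    · have := hasDerivAt_of_eq_radialMean (hYfix (.inr (.inl i))) hs.1 hsR
        (y := κ p i) (hYy _)
      refine this.congr_deriv ?_
      rw [← hev]
      push_cast
      simp only [fuchsianRHS, Sum.elim_inl, Sum.elim_inr, σ]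
      ring
    · have h1 : Y (.inr (.inr (.inl i))) = radialMean 1 (Y (.inr (.inl i))) := by
        rw [hYfix (.inr (.inr (.inl i))), hYfix (.inr (.inl i))]
        rfl
      have := hasDerivAt_of_eq_radialMean h1 hs.1 hsR (y := fun t => χ (p, t) i) (hYy _)
      refine this.congr_deriv ?_
      have h2 : Y (.inr (.inl i)) σ = κ p i s := by rw [hYy, hσ]
      rw [← h2]
      push_cast
      simp only [σ]
      ring
    · have := hasDerivAt_of_eq_radialMean (hYfix (.inr (.inr (.inr true)))) hs.1 hsR
        (y := fun t => B (p, t)) (hYy _)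
      refine this.congr_deriv ?_
      rw [← hev]
      push_cast
      simp only [fuchsianRHS, Sum.elim_inr, cond_true, σ]
      ring
    · have := hasDerivAt_of_eq_radialMean (hYfix (.inr (.inr (.inr false)))) hs.1 hsR
        (y := fun t => τ (p, t)) (hYy _)
      refine this.congr_deriv ?_
      rw [← hev]
      push_cast
      simp only [fuchsianRHS, Sum.elim_inr, cond_false, σ]
      ring
    · have h1 := congrArg (fun f : C(unitInterval, ℝ) => f σ) (hYfix (.inl i))
      simp only [hYy, hσ] at h1
      exact h1.trans (hev _)
  refine ⟨fun i => ?_, fun i => ?_, ?_, ?_, fun i => ?_⟩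
  · have h1 := ((hasDerivAt_pow 2 s).mul (hχ i)).const_add (p (some (some i)))
    refine h1.congr_deriv ?_
    have : s ≠ 0 := hs.1.ne'
    field_simp
    push_cast
    ring
  · rw [hh i]
    exact hκ i
  · rw [← hms]
    exact hB
  · rw [← hkin]
    exact hτ
  · rw [hh i, hforce]

end SmallData

section Parameters

variable {n : ℕ}

/-- The rescaling factor of the radius making all parameters small. -/
def scaleFactor (K : ℝ) (P : ℝ × ℝ × (Fin n → ℝ)) : ℝ := K * (1 + P.1 ^ 2 + ∑ i, P.2.2 i ^ 2)

/-- The rescaled parameters. -/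
def scaledParam (K : ℝ) (P : ℝ × ℝ × (Fin n → ℝ)) : Option (Option (Fin n)) → ℝ
  | none => (scaleFactor K P)⁻¹
  | some none => P.1 / scaleFactor K P ^ 2
  | some (some i) => P.2.2 i / scaleFactor K P ^ ((i : ℕ) + 1)

theorem le_scaleFactor {K : ℝ} (hK : 1 ≤ K) (P : ℝ × ℝ × (Fin n → ℝ)) :
    K ≤ scaleFactor K P ∧ K * |P.1| ≤ scaleFactor K P ∧
      ∀ i, K * |P.2.2 i| ≤ scaleFactor K P := by
  have hK0 : 0 ≤ K := zero_le_one.trans hK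
  have hsum : 0 ≤ ∑ i, P.2.2 i ^ 2 := Finset.sum_nonneg fun i _ => sq_nonneg _
  have habs : ∀ x : ℝ, |x| ≤ 1 + x ^ 2 := fun x => by
    nlinarith [sq_nonneg (|x| - 1), sq_abs x, abs_nonneg x]
  have key : ∀ x, x ≤ 1 + P.1 ^ 2 + ∑ i, P.2.2 i ^ 2 → K * x ≤ scaleFactor K P := fun x hx =>
    mul_le_mul_of_nonneg_left hx hK0
  refine ⟨?_, key _ ?_, fun i => key _ ?_⟩
  · simpa using key 1 (by nlinarith [sq_nonneg P.1])
  · linarith [habs P.1]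
  · have := Finset.single_le_sum (f := fun i => P.2.2 i ^ 2) (fun i _ => sq_nonneg _)
      (Finset.mem_univ i)
    linarith [habs (P.2.2 i), sq_nonneg P.1]

theorem scaleFactor_pos {K : ℝ} (hK : 1 ≤ K) (P : ℝ × ℝ × (Fin n → ℝ)) :
    0 < scaleFactor K P :=
  zero_lt_one.trans_le (hK.trans (le_scaleFactor hK P).1)

theorem norm_scaledParam_le {K : ℝ} (hK : 1 ≤ K) (P : ℝ × ℝ × (Fin n → ℝ)) :
    ‖scaledParam K P‖ ≤ K⁻¹ := by
  have hK0 : 0 < K := zero_lt_one.trans_le hK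
  obtain ⟨h1, h2, h3⟩ := le_scaleFactor hK P
  have hc := scaleFactor_pos hK P
  have hpow : ∀ m : ℕ, scaleFactor K P ≤ scaleFactor K P ^ (m + 1) := fun m =>
    le_self_pow₀ (hK.trans h1) m.succ_ne_zero
  have key : ∀ (x : ℝ) (m : ℕ), K * |x| ≤ scaleFactor K P →
      ‖x / scaleFactor K P ^ (m + 1)‖ ≤ K⁻¹ := fun x m hx => by
    rw [norm_div, Real.norm_eq_abs, norm_pow, Real.norm_of_nonneg hc.le, div_le_iff₀ (by positivity),
      ← div_eq_inv_mul, le_div_iff₀' hK0]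
    exact hx.trans (hpow m)
  refine (pi_norm_le_iff_of_nonneg (by positivity)).2 fun o => ?_
  rcases o with _ | _ | i
  · change ‖(scaleFactor K P)⁻¹‖ ≤ K⁻¹
    rw [norm_inv, Real.norm_of_nonneg hc.le]
    exact inv_anti₀ hK0 h1
  · exact key _ 1 h2
  · exact key _ i (h3 i)

theorem analyticAt_scaleFactor (K : ℝ) (P : ℝ × ℝ × (Fin n → ℝ)) :
    AnalyticAt ℝ (scaleFactor K) P := by
  have h : ∀ i, AnalyticAt ℝ (fun P : ℝ × ℝ × (Fin n → ℝ) => P.2.2 i) P := fun i =>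
    ((ContinuousLinearMap.proj (R := ℝ) (φ := fun _ : Fin n => ℝ) i).analyticAt _).comp
      (analyticAt_snd.comp analyticAt_snd)
  exact analyticAt_const.mul ((analyticAt_const.add (analyticAt_fst.pow 2)).add
    (Finset.univ.analyticAt_fun_sum fun i _ => (h i).pow 2))

theorem analyticAt_scaledParam {K : ℝ} (hK : 1 ≤ K) (P : ℝ × ℝ × (Fin n → ℝ)) :
    AnalyticAt ℝ (scaledParam K) P := by
  have h : ∀ i, AnalyticAt ℝ (fun P : ℝ × ℝ × (Fin n → ℝ) => P.2.2 i) P := fun i =>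
    ((ContinuousLinearMap.proj (R := ℝ) (φ := fun _ : Fin n => ℝ) i).analyticAt _).comp
      (analyticAt_snd.comp analyticAt_snd)
  have hc := (scaleFactor_pos hK P).ne'
  refine analyticAt_pi_iff.2 fun o => ?_
  rcases o with _ | _ | i
  · exact (analyticAt_scaleFactor K P).inv hc
  · exact analyticAt_fst.div ((analyticAt_scaleFactor K P).pow 2) (pow_ne_zero _ hc)
  · exact (h i).div ((analyticAt_scaleFactor K P).pow _) (pow_ne_zero _ hc)

end Parameters

theorem isBigO_pow_mul_of_continuousAt {f : ℝ → ℝ} (hf : ContinuousAt f 0) (k : ℕ) :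
    (fun r => r ^ k * f r) =O[𝓝 0] fun r : ℝ => r ^ k := by
  simpa using (isBigO_refl (fun r : ℝ => r ^ k) (𝓝 0)).mul (hf.tendsto.isBigO_one ℝ)

/-- **Local existence near the origin.** For every Λ < 0, S₀ > 0 and
(z̄_2, …, z̄_N) ∈ ℝ^{N−1}, there is ε > 0 and a solution of the su(N) EYM equations on
(0, ε) with m = O(r³), S = S₀ + O(r²), and gauge field of the exact form
u(r) = 1 + Σ_{k=2}^{N} ζ_k(r) v_k r^k with ζ_k analytic at 0 and ζ_k(0) = z̄_k; the
solution is analytic in r and depends analytically on the N+1 parameters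
(Λ, S₀, z̄_2, …, z̄_N). (Here k = i+2, i : Fin (N−1), and the v_k are a fixed choice of
eigenvectors of A with eigenvalue k(k−1).) -/
theorem local_existence_origin (N : ℕ) (hN : 2 ≤ N)
    (v : Fin (N - 1) → Fin (N - 1) → ℝ) (hv : IsEigenBasis N v) :
    ∃ (ε : ℝ × ℝ × (Fin (N - 1) → ℝ) → ℝ)
      (mF SF : ℝ × ℝ × (Fin (N - 1) → ℝ) → ℝ → ℝ)
      (ωF : ℝ × ℝ × (Fin (N - 1) → ℝ) → ℕ → ℝ → ℝ)
      (ζF : ℝ × ℝ × (Fin (N - 1) → ℝ) → Fin (N - 1) → ℝ → ℝ),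
      ∀ (Λ : ℝ), Λ < 0 → ∀ (S₀ : ℝ), 0 < S₀ → ∀ z : Fin (N - 1) → ℝ,
        0 < ε (Λ, S₀, z) ∧
        (∀ r ∈ Set.Ioo (0 : ℝ) (ε (Λ, S₀, z)),
          EYM N Λ (mF (Λ, S₀, z)) (SF (Λ, S₀, z)) (ωF (Λ, S₀, z)) r) ∧
        (mF (Λ, S₀, z) =O[𝓝[>] (0 : ℝ)] fun r => r ^ 3) ∧
        ((fun r => SF (Λ, S₀, z) r - S₀) =O[𝓝[>] (0 : ℝ)] fun r => r ^ 2) ∧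
        (∀ i : Fin (N - 1), ζF (Λ, S₀, z) i 0 = z i) ∧
        (∀ j : Fin (N - 1), ∀ r ∈ Set.Ioo (0 : ℝ) (ε (Λ, S₀, z)),
          ωF (Λ, S₀, z) ((j : ℕ) + 1) r
            = Real.sqrt (((j : ℕ) + 1 : ℝ) * ((N : ℝ) - ((j : ℕ) + 1)))
              * (1 + ∑ i : Fin (N - 1),
                    ζF (Λ, S₀, z) i r * v i j * r ^ ((i : ℕ) + 2))) ∧
        (∀ i : Fin (N - 1),
          AnalyticAt ℝ
            (fun q : (ℝ × ℝ × (Fin (N - 1) → ℝ)) × ℝ => ζF q.1 i q.2) ((Λ, S₀, z), 0)) ∧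
        AnalyticAt ℝ
          (fun q : (ℝ × ℝ × (Fin (N - 1) → ℝ)) × ℝ => mF q.1 q.2) ((Λ, S₀, z), 0) ∧
        AnalyticAt ℝ
          (fun q : (ℝ × ℝ × (Fin (N - 1) → ℝ)) × ℝ => SF q.1 q.2) ((Λ, S₀, z), 0) := by
  obtain ⟨C, hC0, hC⟩ := exists_structure_constants hv
  obtain ⟨δ, hδ, χ, B, τ, han, hsys⟩ := exists_small_solution v C
  set K : ℝ := 1 + δ⁻¹ with hKdef
  have hK : 1 ≤ K := by
    have := inv_pos.2 hδ
    linarith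
  have hKδ : K⁻¹ < δ := by
    rw [inv_lt_comm₀ (by positivity) hδ]
    linarith
  let c : ℝ × ℝ × (Fin (N - 1) → ℝ) → ℝ := scaleFactor K
  let p : ℝ × ℝ × (Fin (N - 1) → ℝ) → Option (Option (Fin (N - 1))) → ℝ := scaledParam K
  have hc : ∀ P, 0 < c P := scaleFactor_pos hK
  have hp : ∀ P, ‖p P‖ < δ := fun P => (norm_scaledParam_le hK P).trans_lt hKδ
  let ζF : ℝ × ℝ × (Fin (N - 1) → ℝ) → Fin (N - 1) → ℝ → ℝ := fun P i r =>
    c P ^ ((i : ℕ) + 1) * (p P (some (some i)) + (c P * r) ^ 2 * χ (p P, c P * r) i)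
  have hcan : ∀ P, AnalyticAt ℝ (fun q : (ℝ × ℝ × (Fin (N - 1) → ℝ)) × ℝ => c q.1) (P, 0) :=
    fun P => AnalyticAt.comp (g := c) (f := Prod.fst) (analyticAt_scaleFactor K P) analyticAt_fst
  have hcran : ∀ P, AnalyticAt ℝ (fun q : (ℝ × ℝ × (Fin (N - 1) → ℝ)) × ℝ => c q.1 * q.2) (P, 0) :=
    fun P => (hcan P).mul analyticAt_snd
  have hpan : ∀ P, AnalyticAt ℝ (fun q : (ℝ × ℝ × (Fin (N - 1) → ℝ)) × ℝ => p q.1) (P, 0) :=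
    fun P => AnalyticAt.comp (g := p) (f := Prod.fst) (analyticAt_scaledParam hK P) analyticAt_fst
  have hcomp : ∀ P (f : (Option (Option (Fin (N - 1))) → ℝ) × ℝ → ℝ),
      (∀ q, ‖q‖ < δ → AnalyticAt ℝ f q) → AnalyticAt ℝ
        (fun q : (ℝ × ℝ × (Fin (N - 1) → ℝ)) × ℝ => f (p q.1, c q.1 * q.2)) (P, 0) := by
    intro P f hf
    refine AnalyticAt.comp (g := f) (f := fun q : (ℝ × ℝ × (Fin (N - 1) → ℝ)) × ℝ =>
      (p q.1, c q.1 * q.2)) (hf (p P, c P * 0) ?_) ((hpan P).prod (hcran P))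
    simpa [Prod.norm_def] using hp P
  have hBan : ∀ P, AnalyticAt ℝ (fun q : (ℝ × ℝ × (Fin (N - 1) → ℝ)) × ℝ =>
      c q.1 ^ 2 * B (p q.1, c q.1 * q.2)) (P, 0) := fun P =>
    ((hcan P).pow 2).mul (hcomp P B fun q hq => (han q hq).2.1)
  have hτan : ∀ P, AnalyticAt ℝ (fun q : (ℝ × ℝ × (Fin (N - 1) → ℝ)) × ℝ =>
      c q.1 ^ 2 * τ (p q.1, c q.1 * q.2)) (P, 0) := fun P =>
    ((hcan P).pow 2).mul (hcomp P τ fun q hq => (han q hq).2.2)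
  have hslice : ∀ P {f : (ℝ × ℝ × (Fin (N - 1) → ℝ)) × ℝ → ℝ}, AnalyticAt ℝ f (P, 0) →
      ContinuousAt (fun r : ℝ => f (P, r)) 0 := fun P f hf =>
    ContinuousAt.comp (g := f) (f := fun r : ℝ => (P, r)) hf.continuousAt (by fun_prop)
  refine ⟨fun P => δ / c P, fun P r => r ^ 3 * (c P ^ 2 * B (p P, c P * r)),
    fun P r => P.2.1 * Real.exp (2 * r ^ 2 * (c P ^ 2 * τ (p P, c P * r))),
    fun P => gaugeField v (ζF P), ζF, fun Λ _ S₀ _ z => ?_⟩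
  obtain ⟨κ, h, hmodes⟩ := hsys (p (Λ, S₀, z)) (hp _)
  have hc0 := hc (Λ, S₀, z)
  refine ⟨div_pos hδ hc0, fun r hr => ?_, ?_, ?_, fun i => ?_, fun j r _ => ?_, fun i => ?_, ?_, ?_⟩
  · have hΛ : c (Λ, S₀, z) ^ 2 * p (Λ, S₀, z) (some none) = Λ :=
      mul_div_cancel₀ Λ (pow_ne_zero 2 hc0.ne')
    have hsc : ∀ s ∈ Set.Ioo 0 (δ / c (Λ, S₀, z)), _ := fun s hs =>
      (hmodes (c (Λ, S₀, z) * s) ⟨mul_pos hc0 hs.1, (lt_div_iff₀' hc0).1 hs.2⟩).scale hC0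
        (inv_mul_cancel₀ hc0.ne')
    rw [hΛ] at hsc
    exact eym_of_modes hv hC0 hC S₀ hsc hr
  · exact (isBigO_pow_mul_of_continuousAt (hslice _ (hBan _)) 3).mono nhdsWithin_le_nhds
  · have hcont := hslice _ (hτan (Λ, S₀, z))
    have hO := (isBigO_pow_mul_of_continuousAt hcont 2).const_mul_left 2
    have ht : Tendsto (fun r : ℝ => 2 * (r ^ 2 * (c (Λ, S₀, z) ^ 2 *
        τ (p (Λ, S₀, z), c (Λ, S₀, z) * r)))) (𝓝 0) (𝓝 0) := by
      refine hO.trans_tendsto ?_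
      have : ContinuousAt (fun r : ℝ => r ^ 2) 0 := by fun_prop
      simpa using this.tendsto
    have hexp := ((Real.hasDerivAt_exp 0).isBigO_sub.comp_tendsto ht).trans
      (by simpa [Function.comp_def] using hO)
    refine ((hexp.const_mul_left S₀).congr_left fun r => ?_).mono nhdsWithin_le_nhds
    simp only [Function.comp, Real.exp_zero]
    ring_nf
  · have : c (Λ, S₀, z) ^ ((i : ℕ) + 1) * p (Λ, S₀, z) (some (some i)) = z i :=
      mul_div_cancel₀ (z i) (pow_ne_zero _ hc0.ne')
    simp [ζF, this]
  · simp only [gaugeField, weight, modeSum, vExt_succ, smul_eq_mul, Finset.mul_sum]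
    push_cast
    congr 2
    exact Finset.sum_congr rfl fun i _ => by ring
  · exact ((hcan _).pow _).mul ((analyticAt_pi_iff.1 (hpan _) _).add
      (((hcran _).pow 2).mul (hcomp _ (fun q => χ q i) fun q hq => (han q hq).1 i)))
  · exact (analyticAt_snd.pow 3).mul (hBan _)
  · exact (analyticAt_fst.comp (analyticAt_snd.comp analyticAt_fst)).mul
      (analyticAt_rexp.comp ((analyticAt_const.mul (analyticAt_snd.pow 2)).mul (hτan _)))
end
end
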